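/- Uniform a priori bound: for every α ∈ [0,1] and every integer N ≥ 3, writing b_N := binom(N,2) · (3/4)^{N−2}, one has E^N_N(α) ≥ [ b_N / ( (1 + 4√2)² + 2 b_N ) ] · E^N_2(α). -/

import Mathlib

noncomputable section

open MeasureTheory Real Set
open scoped BigOperators Topology

/-- The plane `ℝ²`, with points written as pairs. -/
abbrev Plane : Type := ℝ × ℝ

/-- Configuration space of `N` particles in the plane. -/
abbrev Config (N : ℕ) : Type := Fin N → Plane

/-- `x^{-⊥} := (-y, x)/(x² + y²)` for `x = (x, y) ∈ ℝ²`. -/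
def perpInv (v : Plane) : Plane :=
  (-v.2 / (v.1 ^ 2 + v.2 ^ 2), v.1 / (v.1 ^ 2 + v.2 ^ 2))

/-- The Aharonov–Bohm potential `A_j(x) = ∑_{k ≠ j} (x_j - x_k)^{-⊥}`. -/
def abPot (N : ℕ) (j : Fin N) (x : Config N) : Plane :=
  ∑ k ∈ Finset.univ.erase j, perpInv (x j - x k)

/-- Partial derivative of `Ψ` at `x` in direction `v` of the `j`-th particle. -/
def pder (N : ℕ) (j : Fin N) (v : Plane) (Ψ : Config N → ℂ) (x : Config N) : ℂ :=
  fderiv ℝ Ψ x (Pi.single j v)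

/-- The two components of `D_j Ψ = -i ∇_{x_j} Ψ + α A_j Ψ` at `x`. -/
def DOp (N : ℕ) (α : ℝ) (j : Fin N) (Ψ : Config N → ℂ) (x : Config N) : ℂ × ℂ :=
  (-Complex.I * pder N j (1, 0) Ψ x + Complex.ofReal (α * (abPot N j x).1) * Ψ x,
   -Complex.I * pder N j (0, 1) Ψ x + Complex.ofReal (α * (abPot N j x).2) * Ψ x)

/-- `|D_j Ψ(x)|²`, the squared Euclidean norm of the vector `D_j Ψ(x) ∈ ℂ²`. -/
def DSq (N : ℕ) (α : ℝ) (j : Fin N) (Ψ : Config N → ℂ) (x : Config N) : ℝ :=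
  ‖(DOp N α j Ψ x).1‖ ^ 2 + ‖(DOp N α j Ψ x).2‖ ^ 2

/-- The diagonal set `{x : x_j = x_k for some j ≠ k}`. -/
def diagSet (N : ℕ) : Set (Config N) := {x | ∃ j k : Fin N, j ≠ k ∧ x j = x k}

/-- Admissible wave functions: smooth, symmetric, vanishing on a neighbourhood of
the diagonal set. -/
structure Admissible (N : ℕ) (Ψ : Config N → ℂ) : Prop where
  smooth : ContDiff ℝ (⊤ : ℕ∞) Ψ
  symm : ∀ (σ : Equiv.Perm (Fin N)) (x : Config N), Ψ (x ∘ σ) = Ψ x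
  vanishes : ∃ U : Set (Config N), IsOpen U ∧ diagSet N ⊆ U ∧ ∀ x ∈ U, Ψ x = 0

/-- `Ω^N` as a subset of configuration space. -/
def cube (N : ℕ) (Ω : Set Plane) : Set (Config N) := Set.univ.pi fun _ => Ω

/-- Total kinetic energy `∑_j ∫_{Ω^N} |D_j Ψ|²`. -/
def kinE (N : ℕ) (α : ℝ) (Ω : Set Plane) (Ψ : Config N → ℂ) : ℝ :=
  ∑ j, ∫ x in cube N Ω, DSq N α j Ψ x

/-- `∫_{Ω^N} |Ψ|²`. -/
def normSq (N : ℕ) (Ω : Set Plane) (Ψ : Config N → ℂ) : ℝ :=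
  ∫ x in cube N Ω, ‖Ψ x‖ ^ 2

/-- Neumann ground-state energy of `N` anyons with statistics parameter `α` on `Ω`,
with the convention that it is `0` for `N = 0`. -/
def neumannE (N : ℕ) (α : ℝ) (Ω : Set Plane) : ℝ :=
  if N = 0 then 0 else
    sInf {E | ∃ Ψ : Config N → ℂ, Admissible N Ψ ∧ normSq N Ω Ψ = 1 ∧ E = kinE N α Ω Ψ}

/-- Dirichlet ground-state energy of `N` anyons with statistics parameter `α` on `Ω`. -/
def dirichletE (N : ℕ) (α : ℝ) (Ω : Set Plane) : ℝ :=
  sInf {E | ∃ Ψ : Config N → ℂ, Admissible N Ψ ∧ IsCompact (tsupport Ψ) ∧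
    tsupport Ψ ⊆ cube N Ω ∧ normSq N Ω Ψ = 1 ∧ E = kinE N α Ω Ψ}

/-- The open unit square `Q₀ = (0,1)²`. -/
def Q0 : Set Plane := Set.Ioo (0 : ℝ) 1 ×ˢ Set.Ioo (0 : ℝ) 1

/-- `E^N_N(α)`, the Neumann energy on the unit square. -/
def EN (N : ℕ) (α : ℝ) : ℝ := neumannE N α Q0

/-- `E^D_N(α)`, the Dirichlet energy on the unit square. -/
def ED (N : ℕ) (α : ℝ) : ℝ := dirichletE N α Q0

/-- One-particle density `ρ_Ψ` of a wave function of `n+1` particles. -/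
def density (n : ℕ) (Ψ : Config (n + 1) → ℂ) (y : Plane) : ℝ :=
  (n + 1) * ∫ z : Config n, ‖Ψ (Fin.cons y z)‖ ^ 2

/-- Half-interval Wirtinger inequality with constant `9 < π²`. -/
theorem wirtinger_half (F F' : ℝ → ℝ) (hF : ∀ x, HasDerivAt F (F' x) x) (hc : Continuous F')
    (h0 : F 0 = 0) :
    9 * ∫ x in (0:ℝ)..(1/2), F x ^ 2 ≤ ∫ x in (0:ℝ)..(1/2), F' x ^ 2 := by
  have hFc : Continuous F := continuous_iff_continuousAt.2 fun x => (hF x).continuousAt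
  have hcos : ∀ x ∈ uIcc (0:ℝ) (1/2), 0 < Real.cos (3 * (1/2 - x)) := by
    intro x hx
    rw [uIcc_of_le (by norm_num)] at hx
    apply Real.cos_pos_of_mem_Ioo
    have := Real.pi_gt_three
    constructor <;> linarith [hx.1, hx.2]
  set p : ℝ → ℝ := fun x => 3 * Real.tan (3 * (1/2 - x)) with hp
  have hpd : ∀ x ∈ uIcc (0:ℝ) (1/2), HasDerivAt p (-(9 + p x ^ 2)) x := by
    intro x hx
    have h1 : HasDerivAt (fun y : ℝ => 3 * (1/2 - y)) (-3) x := by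
      have := ((hasDerivAt_id x).const_sub (1/2)).const_mul 3
      simpa using this
    have h2 := ((Real.hasDerivAt_tan (hcos x hx).ne').comp x h1).const_mul 3
    refine h2.congr_deriv ?_
    simp only [hp, Real.tan_eq_sin_div_cos]
    have := (hcos x hx).ne'
    have h3 := Real.sin_sq_add_cos_sq (3 * (1/2 - x))
    generalize 3 * (1/2 - x) = y at *
    field_simp
    nlinarith [h3]
  have hpc : ContinuousOn p (uIcc 0 (1/2)) := fun x hx => (hpd x hx).continuousAt.continuousWithinAt
  have key : ∫ x in (0:ℝ)..(1/2), (-(9 + p x ^ 2) * F x ^ 2 + p x * (2 * F x * F' x)) = 0 := by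
    rw [intervalIntegral.integral_eq_sub_of_hasDerivAt (f := fun x => p x * F x ^ 2)]
    · simp [hp, h0]
    · intro x hx
      have h := (hpd x hx).mul ((hF x).pow 2)
      refine h.congr_deriv ?_
      simp
    · apply ContinuousOn.intervalIntegrable
      fun_prop
  have hI : 0 ≤ ∫ x in (0:ℝ)..(1/2), (F' x - p x * F x) ^ 2 := by
    apply intervalIntegral.integral_nonneg (by norm_num)
    intro x _; positivity
  have e : ∫ x in (0:ℝ)..(1/2), (F' x - p x * F x) ^ 2 =
      (∫ x in (0:ℝ)..(1/2), F' x ^ 2) - 9 * (∫ x in (0:ℝ)..(1/2), F x ^ 2)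
       - ∫ x in (0:ℝ)..(1/2), (-(9 + p x ^ 2) * F x ^ 2 + p x * (2 * F x * F' x)) := by
    rw [← intervalIntegral.integral_const_mul, ← intervalIntegral.integral_sub,
      ← intervalIntegral.integral_sub]
    · congr 1; ext x; ring
    all_goals
      apply ContinuousOn.intervalIntegrable
      fun_prop
  rw [key] at e
  linarith

/-- One-dimensional Poincare inequality. -/
theorem poincare_interval (f f' : ℝ → ℝ) (hf : ∀ x, HasDerivAt f (f' x) x) (hc : Continuous f') :
    9 * ((∫ x in (0:ℝ)..1, f x ^ 2) - (∫ x in (0:ℝ)..1, f x) ^ 2) ≤ ∫ x in (0:ℝ)..1, f' x ^ 2 := by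
  have hfc : Continuous f := continuous_iff_continuousAt.2 fun x => (hf x).continuousAt
  set m := f (1/2)
  have A := wirtinger_half (fun t => f (1/2 + t) - m) (fun t => f' (1/2 + t))
    (fun x => by simpa using ((hf (1/2 + x)).comp_const_add (1/2) x).sub_const m) (by fun_prop) (by simp [m])
  have B := wirtinger_half (fun t => f (1/2 - t) - m) (fun t => - f' (1/2 - t))
    (fun x => by simpa using ((hf (1/2 - x)).comp_const_sub (1/2) x).sub_const m) (by fun_prop) (by simp [m])
  rw [intervalIntegral.integral_comp_add_left (f := fun t => (f t - m)^2),
     intervalIntegral.integral_comp_add_left (f := fun t => (f' t)^2)] at A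
  simp only [neg_sq] at B
  rw [intervalIntegral.integral_comp_sub_left (f := fun t => (f t - m)^2),
     intervalIntegral.integral_comp_sub_left (f := fun t => (f' t)^2)] at B
  norm_num at A B
  have C1 : (∫ x in (0:ℝ)..(1/2), (f x - m)^2) + ∫ x in (1/2:ℝ)..1, (f x - m)^2
      = ∫ x in (0:ℝ)..1, (f x - m)^2 :=
    intervalIntegral.integral_add_adjacent_intervals
      (Continuous.intervalIntegrable (by fun_prop) _ _) (Continuous.intervalIntegrable (by fun_prop) _ _)
  have C2 : (∫ x in (0:ℝ)..(1/2), (f' x)^2) + ∫ x in (1/2:ℝ)..1, (f' x)^2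
      = ∫ x in (0:ℝ)..1, (f' x)^2 :=
    intervalIntegral.integral_add_adjacent_intervals
      (Continuous.intervalIntegrable (by fun_prop) _ _) (Continuous.intervalIntegrable (by fun_prop) _ _)
  have E : ∫ x in (0:ℝ)..1, (f x - m)^2 = (∫ x in (0:ℝ)..1, f x ^2) - 2 * m * (∫ x in (0:ℝ)..1, f x) + m ^2 := by
    have : ∀ x, (f x - m)^2 = f x ^ 2 - 2 * m * f x + m ^ 2 := fun x => by ring
    simp_rw [this]
    rw [intervalIntegral.integral_add, intervalIntegral.integral_sub, intervalIntegral.integral_const_mul]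
    · simp
    all_goals
      apply Continuous.intervalIntegrable
      fun_prop
  nlinarith [sq_nonneg ((∫ x in (0:ℝ)..1, f x) - m)]

theorem integrable_of_ae_bdd {X : Type*} [MeasurableSpace X] (μ : Measure X) [IsFiniteMeasure μ]
    (f : X → ℝ) (hf : AEStronglyMeasurable f μ) (C : ℝ) (hC : ∀ᵐ x ∂μ, |f x| ≤ C) : Integrable f μ :=
  Integrable.of_bound hf C hC

/-- Efron-Stein inequality for two factors. -/
theorem efron_stein {X Y : Type*} [MeasurableSpace X] [MeasurableSpace Y] (μ : Measure X)
    (ν : Measure Y) [IsProbabilityMeasure μ] [IsProbabilityMeasure ν] (F : X × Y → ℝ)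
    (hF : StronglyMeasurable F) (C : ℝ) (hC : ∀ᵐ p ∂(μ.prod ν), |F p| ≤ C) :
    Integrable (fun y => (∫ x, F (x, y) ^ 2 ∂μ) - (∫ x, F (x, y) ∂μ) ^ 2) ν ∧
    Integrable (fun x => (∫ y, F (x, y) ^ 2 ∂ν) - (∫ y, F (x, y) ∂ν) ^ 2) μ ∧
    (∫ p, F p ^ 2 ∂(μ.prod ν)) - (∫ p, F p ∂(μ.prod ν)) ^ 2 ≤
      (∫ y, ((∫ x, F (x, y) ^ 2 ∂μ) - (∫ x, F (x, y) ∂μ) ^ 2) ∂ν) +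
      (∫ x, ((∫ y, F (x, y) ^ 2 ∂ν) - (∫ y, F (x, y) ∂ν) ^ 2) ∂μ) := by
  set a : Y → ℝ := fun y => ∫ x, F (x, y) ∂μ with ha
  set b : X → ℝ := fun x => ∫ y, F (x, y) ∂ν with hb
  set m := ∫ p, F p ∂(μ.prod ν) with hm
  have ham : StronglyMeasurable a := hF.integral_prod_left'
  have hbm : StronglyMeasurable b := hF.integral_prod_right'
  have hxy : ∀ᵐ x ∂μ, ∀ᵐ y ∂ν, |F (x, y)| ≤ C := Measure.ae_ae_of_ae_prod hC
  have hyx : ∀ᵐ y ∂ν, ∀ᵐ x ∂μ, |F (x, y)| ≤ C := by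
    have h2 : ∀ᵐ p ∂(ν.prod μ), |F p.swap| ≤ C := by
      have := (Measure.measurePreserving_swap (μ := ν) (ν := μ)).quasiMeasurePreserving.ae hC
      exact this
    exact Measure.ae_ae_of_ae_prod h2
  have hbC : ∀ᵐ x ∂μ, |b x| ≤ C := by
    filter_upwards [hxy] with x hx
    have := norm_integral_le_of_norm_le_const (μ := ν) (f := fun y => F (x, y)) hx
    simpa using this
  have haC : ∀ᵐ y ∂ν, |a y| ≤ C := by
    filter_upwards [hyx] with x hx
    have := norm_integral_le_of_norm_le_const (μ := μ) (f := fun y => F (y, x)) hx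
    simpa using this
  have haC' : ∀ᵐ p ∂(μ.prod ν), |a p.2| ≤ C := 
    (Measure.quasiMeasurePreserving_snd (μ := μ) (ν := ν)).ae haC
  have hbC' : ∀ᵐ p ∂(μ.prod ν), |b p.1| ≤ C := 
    (Measure.quasiMeasurePreserving_fst (μ := μ) (ν := ν)).ae hbC
  have ham' : StronglyMeasurable (fun p : X × Y => a p.2) := ham.comp_measurable measurable_snd
  have hbm' : StronglyMeasurable (fun p : X × Y => b p.1) := hbm.comp_measurable measurable_fst
  -- products of bounded functions are integrable
  have hIntg : ∀ f g : X × Y → ℝ, StronglyMeasurable f → StronglyMeasurable g →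
      (∀ᵐ p ∂(μ.prod ν), |f p| ≤ C) → (∀ᵐ p ∂(μ.prod ν), |g p| ≤ C) →
      Integrable (fun p => f p * g p) (μ.prod ν) := by
    intro f g hf hg hfC hgC
    apply integrable_of_ae_bdd _ _ (hf.mul hg).aestronglyMeasurable (C * C)
    filter_upwards [hfC, hgC] with p h1 h2
    simp only [Pi.mul_apply, abs_mul]
    exact mul_le_mul h1 h2 (abs_nonneg _) ((abs_nonneg _).trans h1)
  have iF : Integrable F (μ.prod ν) := integrable_of_ae_bdd _ _ hF.aestronglyMeasurable C hC
  have ia : Integrable (fun p : X × Y => a p.2) (μ.prod ν) :=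
    integrable_of_ae_bdd _ _ ham'.aestronglyMeasurable C haC'
  have ib : Integrable (fun p : X × Y => b p.1) (μ.prod ν) :=
    integrable_of_ae_bdd _ _ hbm'.aestronglyMeasurable C hbC'
  have iFF := hIntg F F hF hF hC hC
  have iFa := hIntg F _ hF ham' hC haC'
  have iFb := hIntg F _ hF hbm' hC hbC'
  have iaa := hIntg _ _ ham' ham' haC' haC'
  have ibb := hIntg _ _ hbm' hbm' hbC' hbC'
  have iab := hIntg _ _ ham' hbm' haC' hbC'
  have ema : ∫ y, a y ∂ν = m := (integral_prod_symm F iF).symm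
  have emb : ∫ x, b x ∂μ = m := (integral_prod F iF).symm
  have eFa : ∫ p, F p * a p.2 ∂(μ.prod ν) = ∫ y, a y ^ 2 ∂ν := by
    rw [integral_prod_symm _ iFa]
    congr 1; ext y
    simp only [integral_mul_const]
    rw [sq]
  have eFb : ∫ p, F p * b p.1 ∂(μ.prod ν) = ∫ x, b x ^ 2 ∂μ := by
    rw [integral_prod _ iFb]
    congr 1; ext y
    simp only [integral_mul_const]
    rw [sq]
  have eaa : ∫ p, a p.2 * a p.2 ∂(μ.prod ν) = ∫ y, a y ^ 2 ∂ν := by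
    rw [integral_prod_symm _ iaa]
    simp [sq]
  have ebb : ∫ p, b p.1 * b p.1 ∂(μ.prod ν) = ∫ y, b y ^ 2 ∂μ := by
    rw [integral_prod _ ibb]
    simp [sq]
  have eab : ∫ p, a p.2 * b p.1 ∂(μ.prod ν) = m ^ 2 := by
    rw [integral_prod _ iab]
    simp only [integral_mul_const, integral_const_mul, ema, emb]
    rw [sq]
  have ea : ∫ p, a p.2 ∂(μ.prod ν) = m := by
    rw [integral_prod_symm _ ia]; simp [ema]
  have eb : ∫ p, b p.1 ∂(μ.prod ν) = m := by
    rw [integral_prod _ ib]; simp [emb]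
  have ia1 : Integrable (fun y => ∫ x, F (x, y) ^ 2 ∂μ) ν := by
    simpa [sq] using iFF.integral_prod_right
  have ia2 : Integrable (fun y => a y ^ 2) ν := by
    apply integrable_of_ae_bdd _ _ (ham.pow 2).aestronglyMeasurable (C^2)
    filter_upwards [haC] with y hy
    simpa using pow_le_pow_left₀ (abs_nonneg _) hy 2
  have ib1 : Integrable (fun x => ∫ y, F (x, y) ^ 2 ∂ν) μ := by
    simpa [sq] using iFF.integral_prod_left
  have ib2 : Integrable (fun x => b x ^ 2) μ := by
    apply integrable_of_ae_bdd _ _ (hbm.pow 2).aestronglyMeasurable (C^2)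
    filter_upwards [hbC] with y hy
    simpa using pow_le_pow_left₀ (abs_nonneg _) hy 2
  refine ⟨ia1.sub ia2, ib1.sub ib2, ?_⟩
  have e1 : ∫ y, ((∫ x, F (x, y) ^ 2 ∂μ) - a y ^ 2) ∂ν =
      (∫ p, F p * F p ∂(μ.prod ν)) - ∫ y, a y ^ 2 ∂ν := by
    rw [integral_prod_symm _ iFF, integral_sub ia1 ia2]
    simp [sq]
  have e2 : ∫ x, ((∫ y, F (x, y) ^ 2 ∂ν) - b x ^ 2) ∂μ =
      (∫ p, F p * F p ∂(μ.prod ν)) - ∫ y, b y ^ 2 ∂μ := by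
    rw [integral_prod _ iFF, integral_sub ib1 ib2]
    simp [sq]
  have hnn : 0 ≤ ∫ p, (F p - a p.2 - b p.1 + m) ^ 2 ∂(μ.prod ν) :=
    integral_nonneg fun p => sq_nonneg _
  have hexp : ∫ p, (F p - a p.2 - b p.1 + m) ^ 2 ∂(μ.prod ν) =
      (∫ p, F p * F p ∂(μ.prod ν)) + (∫ p, a p.2 * a p.2 ∂(μ.prod ν)) +
      (∫ p, b p.1 * b p.1 ∂(μ.prod ν)) + m ^ 2 - 2 * (∫ p, F p * a p.2 ∂(μ.prod ν))
      - 2 * (∫ p, F p * b p.1 ∂(μ.prod ν)) + 2 * (∫ p, a p.2 * b p.1 ∂(μ.prod ν))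
      + 2 * m * (∫ p, F p ∂(μ.prod ν)) - 2 * m * (∫ p, a p.2 ∂(μ.prod ν))
      - 2 * m * (∫ p, b p.1 ∂(μ.prod ν)) := by
    have hm2 : m ^ 2 = ∫ p, m ^ 2 ∂(μ.prod ν) := by simp
    rw [hm2]
    have ia3 := ia.const_mul (2 * m)
    have ib3 := ib.const_mul (2 * m)
    simp only [← integral_const_mul]
    rw [← integral_add iFF iaa, ← integral_add (by fun_prop) ibb, ← integral_add (by fun_prop) (by fun_prop),
      ← integral_sub (by fun_prop) (by fun_prop), ← integral_sub (by fun_prop) (by fun_prop),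
      ← integral_add (by fun_prop) (by fun_prop), ← integral_add (by fun_prop) (by fun_prop),
      ← integral_sub (by fun_prop) ia3, ← integral_sub ?_ ib3]
    · congr 1; ext p; ring
    · exact Integrable.sub (by fun_prop) ia3
  rw [e1, e2]
  have : ∫ p, F p ^ 2 ∂(μ.prod ν) = ∫ p, F p * F p ∂(μ.prod ν) := by simp [sq]
  rw [this]
  rw [hexp, eaa, ebb, eFa, eFb, eab, ea, eb, ← hm] at hnn
  nlinarith

/-- Tensorization of a Poincare-type inequality. -/
theorem poincare_tensor {X Y : Type*} [MeasurableSpace X] [MeasurableSpace Y] (μ : Measure X)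
    (ν : Measure Y) [IsProbabilityMeasure μ] [IsProbabilityMeasure ν] (F G₁ G₂ : X × Y → ℝ)
    (hF : StronglyMeasurable F) (C : ℝ) (hC : ∀ᵐ p ∂(μ.prod ν), |F p| ≤ C)
    (h1 : Integrable G₁ (μ.prod ν)) (h2 : Integrable G₂ (μ.prod ν))
    (H1 : ∀ y, 9 * ((∫ x, F (x, y) ^ 2 ∂μ) - (∫ x, F (x, y) ∂μ) ^ 2) ≤ ∫ x, G₁ (x, y) ∂μ)
    (H2 : ∀ x, 9 * ((∫ y, F (x, y) ^ 2 ∂ν) - (∫ y, F (x, y) ∂ν) ^ 2) ≤ ∫ y, G₂ (x, y) ∂ν) :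
    9 * ((∫ p, F p ^ 2 ∂(μ.prod ν)) - (∫ p, F p ∂(μ.prod ν)) ^ 2) ≤ 
      ∫ p, (G₁ p + G₂ p) ∂(μ.prod ν) := by
  obtain ⟨i1, i2, hES⟩ := efron_stein μ ν F hF C hC
  have k1 := integral_mono (i1.const_mul 9) h1.integral_prod_right H1
  have k2 := integral_mono (i2.const_mul 9) h2.integral_prod_left H2
  rw [integral_const_mul, ← integral_prod_symm _ h1] at k1
  rw [integral_const_mul, ← integral_prod _ h2] at k2
  rw [integral_add h1 h2]
  linarith

theorem cube_subset (N : ℕ) : cube N Q0 ⊆ Set.univ.pi fun _ => (Icc (0:ℝ) 1 ×ˢ Icc (0:ℝ) 1) :=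
  Set.pi_mono fun _ _ => Set.prod_mono Ioo_subset_Icc_self Ioo_subset_Icc_self

theorem isCompact_ccube (N : ℕ) :
    IsCompact (Set.univ.pi fun _ : Fin N => (Icc (0:ℝ) 1 ×ˢ Icc (0:ℝ) 1)) :=
  isCompact_univ_pi fun _ => isCompact_Icc.prod isCompact_Icc

theorem measurableSet_Q0 : MeasurableSet Q0 := measurableSet_Ioo.prod measurableSet_Ioo

theorem isOpen_Q0 : IsOpen Q0 := isOpen_Ioo.prod isOpen_Ioo

theorem measurableSet_cube (N : ℕ) : MeasurableSet (cube N Q0) :=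
  MeasurableSet.univ_pi fun _ => measurableSet_Q0

theorem volume_Q0 : (volume : Measure Plane) Q0 = 1 := by
  rw [Q0, Measure.volume_eq_prod, Measure.prod_prod]
  simp

instance instProbQ0 : IsProbabilityMeasure ((volume : Measure Plane).restrict Q0) :=
  ⟨by simp [volume_Q0]⟩

theorem volume_cube (N : ℕ) : (volume : Measure (Config N)) (cube N Q0) = 1 := by
  rw [cube, volume_pi_pi]
  simp [volume_Q0]

instance instProbCube (N : ℕ) : IsProbabilityMeasure ((volume : Measure (Config N)).restrict (cube N Q0)) :=
  ⟨by simp [volume_cube]⟩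

instance instProbIoo : IsProbabilityMeasure ((volume : Measure ℝ).restrict (Ioo 0 1)) :=
  ⟨by simp⟩

theorem integrableOn_cube {E : Type*} [NormedAddCommGroup E] {N : ℕ} {f : Config N → E} (hf : Continuous f) :
    IntegrableOn f (cube N Q0) :=
  (hf.continuousOn.integrableOn_compact (isCompact_ccube N)).mono_set (cube_subset N)

theorem bdd_cube {N : ℕ} {f : Config N → ℝ} (hf : Continuous f) :
    ∃ C, ∀ x ∈ cube N Q0, |f x| ≤ C := by
  obtain ⟨C, hC⟩ := (isCompact_ccube N).exists_bound_of_continuousOn hf.continuousOn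
  exact ⟨C, fun x hx => hC x (cube_subset N hx)⟩

theorem Q0_eq : (volume : Measure Plane).restrict Q0 =
    ((volume : Measure ℝ).restrict (Ioo 0 1)).prod ((volume : Measure ℝ).restrict (Ioo 0 1)) := by
  rw [Q0, Measure.volume_eq_prod, Measure.prod_restrict]

theorem poincare_Ioo (f f' : ℝ → ℝ) (hf : ∀ x, HasDerivAt f (f' x) x) (hc : Continuous f') :
    9 * ((∫ x in Ioo (0:ℝ) 1, f x ^ 2) - (∫ x in Ioo (0:ℝ) 1, f x) ^ 2) ≤ ∫ x in Ioo (0:ℝ) 1, f' x ^ 2 := by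
  have := poincare_interval f f' hf hc
  simpa only [intervalIntegral.integral_of_le (zero_le_one' ℝ), integral_Ioc_eq_integral_Ioo] using this

theorem poincare_Q0 (f : Plane → ℝ) (hf : ContDiff ℝ 1 f) :
    9 * ((∫ x in Q0, f x ^ 2) - (∫ x in Q0, f x) ^ 2) ≤
      ∫ x in Q0, ((fderiv ℝ f x (1, 0)) ^ 2 + (fderiv ℝ f x (0, 1)) ^ 2) := by
  have hd : Continuous (fderiv ℝ f) := hf.continuous_fderiv one_ne_zero
  have hdf : Differentiable ℝ f := hf.differentiable one_ne_zero
  have hK : IsCompact (Icc (0:ℝ) 1 ×ˢ Icc (0:ℝ) 1) := isCompact_Icc.prod isCompact_Icc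
  have hsub : Q0 ⊆ Icc (0:ℝ) 1 ×ˢ Icc (0:ℝ) 1 := Set.prod_mono Ioo_subset_Icc_self Ioo_subset_Icc_self
  have hIntg : ∀ g : Plane → ℝ, Continuous g → Integrable g (volume.restrict Q0) := fun g hg =>
    (hg.continuousOn.integrableOn_compact hK).mono_set hsub
  obtain ⟨C, hC⟩ := hK.exists_bound_of_continuousOn hf.continuous.continuousOn
  have hCae : ∀ᵐ p ∂(volume.restrict Q0), |f p| ≤ C := by
    filter_upwards [ae_restrict_mem measurableSet_Q0] with p hp using hC p (hsub hp)
  have i1 := hIntg (fun x => (fderiv ℝ f x (1, 0)) ^ 2) (by fun_prop)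
  have i2 := hIntg (fun x => (fderiv ℝ f x (0, 1)) ^ 2) (by fun_prop)
  rw [Q0_eq] at hCae i1 i2 ⊢
  refine poincare_tensor _ _ f _ _ hf.continuous.stronglyMeasurable C hCae i1 i2 ?_ ?_
  · intro y
    refine poincare_Ioo (fun x => f (x, y)) (fun x => fderiv ℝ f (x, y) (1, 0)) ?_ ?_
    · intro x
      exact (hdf (x, y)).hasFDerivAt.comp_hasDerivAt x ((hasDerivAt_id x).prodMk (hasDerivAt_const x y))
    · fun_prop
  · intro x
    refine poincare_Ioo (fun y => f (x, y)) (fun y => fderiv ℝ f (x, y) (0, 1)) ?_ ?_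
    · intro y
      exact (hdf (x, y)).hasFDerivAt.comp_hasDerivAt y ((hasDerivAt_const y x).prodMk (hasDerivAt_id y))
    · fun_prop

theorem mp_cons (n : ℕ) : MeasurePreserving (fun p : Plane × Config n => (Fin.cons p.1 p.2 : Config (n+1)))
    ((volume.restrict Q0).prod (volume.restrict (cube n Q0))) (volume.restrict (cube (n+1) Q0)) := by
  have h := (volume_preserving_piFinSuccAbove (fun _ : Fin (n+1) => Plane) 0).symm
  have h2 := h.restrict_preimage (measurableSet_cube (n+1))
  have e : (MeasurableEquiv.piFinSuccAbove (fun _ : Fin (n+1) => Plane) 0).symm ⁻¹' (cube (n+1) Q0)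
     = Q0 ×ˢ cube n Q0 := by
    ext p
    simp [cube, MeasurableEquiv.piFinSuccAbove, Fin.forall_fin_succ, Fin.insertNthEquiv]
  rw [e, Measure.volume_eq_prod, ← Measure.prod_restrict] at h2
  have e2 : (fun p : Plane × Config n => (Fin.cons p.1 p.2 : Config (n+1))) =
      (MeasurableEquiv.piFinSuccAbove (fun _ : Fin (n+1) => Plane) 0).symm := by
    ext p : 1
    simp [MeasurableEquiv.piFinSuccAbove, Fin.insertNthEquiv]
  rw [e2]
  exact h2

/-- Gradient squared of the `j`-th particle. -/
def gsq (n : ℕ) (f : Config n → ℝ) (j : Fin n) (x : Config n) : ℝ :=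
  (fderiv ℝ f x (Pi.single j (1, 0))) ^ 2 + (fderiv ℝ f x (Pi.single j (0, 1))) ^ 2

theorem continuous_gsq (n : ℕ) (f : Config n → ℝ) (hf : ContDiff ℝ 1 f) (j : Fin n) :
    Continuous (gsq n f j) := by
  have hd : Continuous (fderiv ℝ f) := hf.continuous_fderiv one_ne_zero
  unfold gsq
  fun_prop

def consL0 (n : ℕ) : Plane →L[ℝ] Config (n+1) := ContinuousLinearMap.single ℝ (fun _ => Plane) 0

theorem contDiff_cons (n : ℕ) : ContDiff ℝ 1 (fun p : Plane × Config n => (Fin.cons p.1 p.2 : Config (n+1))) := by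
  rw [contDiff_pi]
  intro i
  refine Fin.cases ?_ (fun i => ?_) i
  · simpa using contDiff_fst
  · simp only [Fin.cons_succ]; fun_prop

theorem cube_poincare (n : ℕ) (f : Config n → ℝ) (hf : ContDiff ℝ 1 f) :
    9 * ((∫ x in cube n Q0, f x ^ 2) - (∫ x in cube n Q0, f x) ^ 2) ≤
      ∫ x in cube n Q0, ∑ j, gsq n f j x := by
  induction n with
  | zero =>
    have : ∀ g : Config 0 → ℝ, ∫ x in cube 0 Q0, g x = g default := by
      intro g
      have : g = fun _ => g default := by ext x; rw [Subsingleton.elim x default]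
      rw [this]; simp
    rw [this, this, this]; simp
  | succ n ih =>
    have hdf : Differentiable ℝ f := hf.differentiable one_ne_zero
    have hd : Continuous (fderiv ℝ f) := hf.continuous_fderiv one_ne_zero
    have mp := mp_cons n
    have hcc : Continuous (fun p : Plane × Config n => (Fin.cons p.1 p.2 : Config (n+1))) :=
      (contDiff_cons n).continuous
    have emb : MeasurableEmbedding (fun p : Plane × Config n => (Fin.cons p.1 p.2 : Config (n+1))) := by
      have := (MeasurableEquiv.piFinSuccAbove (fun _ : Fin (n+1) => Plane) 0).symm.measurableEmbedding
      convert this using 1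
      ext p : 1
      simp [MeasurableEquiv.piFinSuccAbove, Fin.insertNthEquiv]
    have hIntg : ∀ g : Config (n+1) → ℝ, Continuous g → Integrable (fun p : Plane × Config n => g (Fin.cons p.1 p.2)) ((volume.restrict Q0).prod (volume.restrict (cube n Q0))) := by
      intro g hg
      exact (mp.integrable_comp_emb emb).2 (integrableOn_cube hg)
    rw [← mp.integral_comp emb, ← mp.integral_comp emb, ← mp.integral_comp emb]
    simp_rw [Fin.sum_univ_succ]
    obtain ⟨C, hC⟩ := bdd_cube hf.continuous
    refine poincare_tensor _ _ (fun p : Plane × Config n => f (Fin.cons p.1 p.2)) (fun p => gsq (n+1) f 0 (Fin.cons p.1 p.2)) (fun p => ∑ j : Fin n, gsq (n+1) f j.succ (Fin.cons p.1 p.2)) (hf.continuous.comp hcc).stronglyMeasurable C ?_ ?_ ?_ ?_ ?_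
    · apply mp.quasiMeasurePreserving.ae (p := fun x => |f x| ≤ C)
      filter_upwards [ae_restrict_mem (measurableSet_cube _)] with p hp using hC p hp
    · exact hIntg _ (continuous_gsq _ _ hf _)
    · exact hIntg (fun x => ∑ j : Fin n, gsq (n+1) f j.succ x) (continuous_finsetSum _ fun j _ => continuous_gsq _ _ hf _)
    · intro y
      have hd : ∀ x, HasFDerivAt (fun x => f (Fin.cons x y)) ((fderiv ℝ f (Fin.cons x y)).comp (ContinuousLinearMap.single ℝ (fun _ => Plane) 0)) x := by
        intro x
        refine (hdf (Fin.cons x y)).hasFDerivAt.comp x ?_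
        rw [hasFDerivAt_pi']
        intro i
        refine Fin.cases ?_ (fun i => ?_) i
        · simp only [Fin.cons_zero]
          refine (hasFDerivAt_id x).congr_fderiv ?_
          ext <;> simp
        · simp only [Fin.cons_succ]
          refine (hasFDerivAt_const _ x).congr_fderiv ?_
          ext <;> simp
      have := poincare_Q0 (fun x => f (Fin.cons x y)) (hf.comp ((contDiff_cons n).comp (contDiff_prodMk_left y)))
      simp only [(hd _).fderiv] at this
      simpa [gsq] using this
    · intro x
      have hd : ∀ y, HasFDerivAt (fun y => f (Fin.cons x y)) ((fderiv ℝ f (Fin.cons x y)).comp (ContinuousLinearMap.pi (Fin.cons 0 fun j => ContinuousLinearMap.proj j))) y := by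
        intro y
        refine (hdf (Fin.cons x y)).hasFDerivAt.comp y ?_
        rw [hasFDerivAt_pi']
        intro i
        refine Fin.cases ?_ (fun i => ?_) i
        · simp only [Fin.cons_zero]
          refine (hasFDerivAt_const _ y).congr_fderiv ?_
          ext <;> simp
        · simp only [Fin.cons_succ]
          refine (hasFDerivAt_apply i y).congr_fderiv ?_
          ext <;> simp
      have := ih (fun y => f (Fin.cons x y)) (hf.comp ((contDiff_cons n).comp (contDiff_prodMk_right x)))
      simp only [gsq, (hd _).fderiv] at this
      have hs : ∀ (j : Fin n) (v : Plane), (ContinuousLinearMap.pi (Fin.cons 0 fun j => ContinuousLinearMap.proj j) : Config n →L[ℝ] Config (n+1)) (Pi.single j v) = Pi.single j.succ v := by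
        intro j v
        ext i : 1
        refine Fin.cases ?_ (fun i => ?_) i
        · simp
        · simp [Pi.single_apply]
      simp only [ContinuousLinearMap.comp_apply, hs] at this
      exact this

theorem sq_add_sq_pos {v : Plane} (hv : v ≠ 0) : 0 < v.1 ^ 2 + v.2 ^ 2 := by
  rcases eq_or_ne v.1 0 with h | h
  · have : v.2 ≠ 0 := fun h2 => hv (Prod.ext h h2)
    positivity
  · positivity

theorem continuousAt_perpInv {v : Plane} (hv : v ≠ 0) : ContinuousAt perpInv v := by
  have := (sq_add_sq_pos hv).ne'
  unfold perpInv
  fun_prop (disch := assumption)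

theorem DSq_nonneg (N : ℕ) (α : ℝ) (j : Fin N) (Ψ : Config N → ℂ) (x : Config N) :
    0 ≤ DSq N α j Ψ x := by unfold DSq; positivity

theorem Admissible.continuous_DSq {N : ℕ} {Ψ : Config N → ℂ} (h : Admissible N Ψ) (α : ℝ) (j : Fin N) :
    Continuous (DSq N α j Ψ) := by
  obtain ⟨U, hUo, hU, hΨ⟩ := h.vanishes
  have hc := h.smooth.continuous
  have hd : Continuous (fderiv ℝ Ψ) := h.smooth.continuous_fderiv (by simp)
  rw [continuous_iff_continuousAt]
  intro x
  by_cases hx : x ∈ U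
  · have hz : ∀ y ∈ U, DSq N α j Ψ y = 0 := by
      intro y hy
      have e : Ψ =ᶠ[𝓝 y] fun _ => 0 := by
        filter_upwards [hUo.mem_nhds hy] with z hz using hΨ z hz
      have : fderiv ℝ Ψ y = 0 := by rw [e.fderiv_eq]; simp
      simp [DSq, DOp, pder, this, hΨ y hy]
    have : DSq N α j Ψ =ᶠ[𝓝 x] fun _ => 0 := by
      filter_upwards [hUo.mem_nhds hx] with z hz' using hz z hz'
    exact this.continuousAt
  · have hx' : x ∉ diagSet N := fun h => hx (hU h)
    have hA : ContinuousAt (abPot N j) x := by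
      unfold abPot
      apply tendsto_finsetSum
      intro k hk
      have hne : x j - x k ≠ 0 := by
        intro h0
        exact hx' ⟨j, k, (Finset.ne_of_mem_erase hk).symm, sub_eq_zero.1 h0⟩
      exact (continuousAt_perpInv hne).comp (f := fun x : Config N => x j - x k) (by fun_prop)
    unfold DSq DOp pder
    have hA1 : ContinuousAt (fun x => Complex.ofReal (α * (abPot N j x).1)) x :=
      Complex.continuous_ofReal.continuousAt.comp (f := fun x => α * (abPot N j x).1) (by fun_prop)
    have hA2 : ContinuousAt (fun x => Complex.ofReal (α * (abPot N j x).2)) x :=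
      Complex.continuous_ofReal.continuousAt.comp (f := fun x => α * (abPot N j x).2) (by fun_prop)
    fun_prop

theorem kinE_eq {N : ℕ} {Ψ : Config N → ℂ} (h : Admissible N Ψ) (α : ℝ) :
    kinE N α Q0 Ψ = ∫ x in cube N Q0, ∑ j, DSq N α j Ψ x := by
  rw [integral_finsetSum]
  · rfl
  · intro j _
    exact integrableOn_cube (h.continuous_DSq α j)

theorem kinE_nonneg (N : ℕ) (Ψ : Config N → ℂ) (α : ℝ) (Ω : Set Plane) :
    0 ≤ kinE N α Ω Ψ := by
  unfold kinE
  exact Finset.sum_nonneg fun j _ => integral_nonneg fun x => DSq_nonneg _ _ _ _ _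

theorem diamag_aux (p q : ℂ) (a u : ℝ) (hu : 0 < u) (hpu : ‖p‖ ≤ u) :
    ((inner ℝ p q) / u) ^ 2 ≤ ‖-Complex.I * q + (a : ℂ) * p‖ ^ 2 := by
  have e : inner ℝ p q = inner ℝ p (Complex.I * (-Complex.I * q + (a : ℂ) * p)) := by
    simp only [Complex.inner, Complex.mul_re, Complex.mul_im, Complex.add_re, Complex.add_im,
      Complex.neg_re, Complex.neg_im, Complex.I_re, Complex.I_im, Complex.ofReal_re, Complex.ofReal_im,
      Complex.conj_re, Complex.conj_im]
    ring
  have h1 : |inner ℝ p q| ≤ ‖p‖ * ‖-Complex.I * q + (a : ℂ) * p‖ := by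
    rw [e]
    refine (abs_real_inner_le_norm _ _).trans ?_
    simp
  rw [← sq_abs, abs_div, abs_of_pos hu]
  apply pow_le_pow_left₀ (by positivity)
  rw [div_le_iff₀ hu, mul_comm]
  exact h1.trans (mul_le_mul_of_nonneg_right hpu (norm_nonneg _))

def ueps {N : ℕ} (ε : ℝ) (Ψ : Config N → ℂ) (x : Config N) : ℝ := Real.sqrt (‖Ψ x‖ ^ 2 + ε ^ 2)

theorem contDiff_ueps {N : ℕ} {Ψ : Config N → ℂ} (h : ContDiff ℝ 1 Ψ) {ε : ℝ} (hε : 0 < ε) :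
    ContDiff ℝ 1 (ueps ε Ψ) := by
  unfold ueps
  apply ContDiff.sqrt
  · exact (h.norm_sq ℝ).add contDiff_const
  · intro x; positivity

theorem gsq_ueps_le {N : ℕ} {Ψ : Config N → ℂ} (h : ContDiff ℝ 1 Ψ) {ε : ℝ} (hε : 0 < ε) (α : ℝ) (j : Fin N)
    (x : Config N) : gsq N (ueps ε Ψ) j x ≤ DSq N α j Ψ x := by
  have hd : HasFDerivAt Ψ (fderiv ℝ Ψ x) x := (h.differentiable one_ne_zero x).hasFDerivAt
  have hpos : 0 < ‖Ψ x‖ ^ 2 + ε ^ 2 := by positivity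
  have h2 : HasFDerivAt (ueps ε Ψ) _ x := ((hd.norm_sq).add_const (ε ^ 2)).sqrt hpos.ne'
  have hu : 0 < ueps ε Ψ x := Real.sqrt_pos.2 hpos
  have hle : ‖Ψ x‖ ≤ ueps ε Ψ x := by
    unfold ueps
    apply Real.le_sqrt_of_sq_le
    nlinarith [sq_nonneg ε]
  have hv : ∀ v, fderiv ℝ (ueps ε Ψ) x v = inner ℝ (Ψ x) (fderiv ℝ Ψ x v) / ueps ε Ψ x := by
    intro v
    rw [h2.fderiv]
    simp only [_root_.smul_apply, ContinuousLinearMap.comp_apply, innerSL_apply_apply, smul_eq_mul]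
    change 1 / (2 * ueps ε Ψ x) * _ = _
    simp
    field_simp
  unfold gsq DSq DOp pder
  rw [hv, hv]
  exact add_le_add (diamag_aux _ _ _ _ hu hle) (diamag_aux _ _ _ _ hu hle)

/-- Poincare inequality for `|Ψ|`, via the diamagnetic inequality. -/
theorem var_norm_le {N : ℕ} {Ψ : Config N → ℂ} (h : Admissible N Ψ) (α : ℝ) :
    9 * (normSq N Q0 Ψ - (∫ x in cube N Q0, ‖Ψ x‖) ^ 2) ≤ kinE N α Q0 Ψ := by
  have h1 : ContDiff ℝ 1 Ψ := h.smooth.of_le (by exact_mod_cast le_top)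
  have hc : Continuous Ψ := h1.continuous
  set m := ∫ x in cube N Q0, ‖Ψ x‖ with hm
  have hm0 : 0 ≤ m := integral_nonneg fun x => norm_nonneg _
  have key : ∀ ε : ℝ, 0 < ε → 9 * (normSq N Q0 Ψ - (m + ε) ^ 2) ≤ kinE N α Q0 Ψ := by
    intro ε hε
    have hP := cube_poincare N (ueps ε Ψ) (contDiff_ueps h1 hε)
    have huc := (contDiff_ueps h1 hε).continuous
    have k1 : ∫ x in cube N Q0, ∑ j, gsq N (ueps ε Ψ) j x ≤ kinE N α Q0 Ψ := by
      rw [kinE_eq h]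
      apply integral_mono
      · exact integrableOn_cube (continuous_finsetSum _ fun j _ => continuous_gsq _ _ (contDiff_ueps h1 hε) _)
      · exact integrableOn_cube (continuous_finsetSum _ fun j _ => h.continuous_DSq _ _)
      · intro x
        exact Finset.sum_le_sum fun j _ => gsq_ueps_le h1 hε α j x
    have k2 : normSq N Q0 Ψ ≤ ∫ x in cube N Q0, ueps ε Ψ x ^ 2 := by
      apply integral_mono
      · exact integrableOn_cube (by fun_prop)
      · exact integrableOn_cube (by fun_prop)
      · intro x
        simp only [ueps]
        rw [Real.sq_sqrt (by positivity)]
        nlinarith [sq_nonneg ε]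
    have k3 : ∫ x in cube N Q0, ueps ε Ψ x ≤ m + ε := by
      have : m + ε = ∫ x in cube N Q0, (‖Ψ x‖ + ε) := by
        rw [integral_add (integrableOn_cube (by fun_prop)) (integrable_const _)]
        simp [← hm]
      rw [this]
      apply integral_mono
      · exact integrableOn_cube (by fun_prop)
      · exact integrableOn_cube (by fun_prop)
      · intro x
        simp only [ueps]
        apply Real.sqrt_le_iff.2 ⟨by positivity, by nlinarith [norm_nonneg (Ψ x)]⟩
    have k4 : 0 ≤ ∫ x in cube N Q0, ueps ε Ψ x := integral_nonneg fun x => Real.sqrt_nonneg _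
    have k5 := pow_le_pow_left₀ k4 k3 2
    linarith
  have ht : Filter.Tendsto (fun ε : ℝ => 9 * (normSq N Q0 Ψ - (m + ε) ^ 2)) (𝓝[>] 0)
      (𝓝 (9 * (normSq N Q0 Ψ - (m + 0) ^ 2))) := by
    apply Filter.Tendsto.mono_left _ nhdsWithin_le_nhds
    apply Continuous.tendsto
    fun_prop
  rw [add_zero] at ht
  refine le_of_tendsto ht ?_
  filter_upwards [self_mem_nhdsWithin] with ε hε using key ε hε

theorem Admissible.const_mul {N : ℕ} {Ψ : Config N → ℂ} (h : Admissible N Ψ) (c : ℝ) :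
    Admissible N (fun x => (c : ℂ) * Ψ x) where
  smooth := contDiff_const.mul h.smooth
  symm σ x := by simp only [h.symm σ x]
  vanishes := by
    obtain ⟨U, h1, h2, h3⟩ := h.vanishes
    exact ⟨U, h1, h2, fun x hx => by simp [h3 x hx]⟩

theorem DSq_const_mul {N : ℕ} {Ψ : Config N → ℂ} (h : Admissible N Ψ) (c α : ℝ) (j : Fin N) (x : Config N) :
    DSq N α j (fun x => (c : ℂ) * Ψ x) x = c ^ 2 * DSq N α j Ψ x := by
  have hd : DifferentiableAt ℝ Ψ x := h.smooth.differentiable (by simp) x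
  have e : ∀ v, fderiv ℝ (fun x => (c : ℂ) * Ψ x) x v = c * fderiv ℝ Ψ x v := by
    intro v
    rw [fderiv_const_mul hd]
    simp
  have e2 : ∀ a b p : ℂ, -Complex.I * (c * a) + b * (c * p) = c * (-Complex.I * a + b * p) := by
    intros; ring
  unfold DSq DOp pder
  simp only [e, e2, norm_mul, mul_pow, Complex.norm_real, Real.norm_eq_abs, sq_abs]
  ring

theorem kinE_const_mul {N : ℕ} {Ψ : Config N → ℂ} (h : Admissible N Ψ) (c α : ℝ) (Ω : Set Plane) :
    kinE N α Ω (fun x => (c : ℂ) * Ψ x) = c ^ 2 * kinE N α Ω Ψ := by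
  unfold kinE
  simp_rw [DSq_const_mul h, integral_const_mul, Finset.mul_sum]

theorem normSq_const_mul {N : ℕ} (Ψ : Config N → ℂ) (c : ℝ) (Ω : Set Plane) :
    normSq N Ω (fun x => (c : ℂ) * Ψ x) = c ^ 2 * normSq N Ω Ψ := by
  unfold normSq
  simp_rw [norm_mul, mul_pow, integral_const_mul, Complex.norm_real, Real.norm_eq_abs, sq_abs]

theorem normSq_nonneg (N : ℕ) (Ψ : Config N → ℂ) (Ω : Set Plane) : 0 ≤ normSq N Ω Ψ :=
  integral_nonneg fun x => by positivity

theorem bddBelow_E (N : ℕ) (α : ℝ) (Ω : Set Plane) :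
    BddBelow {E | ∃ Ψ : Config N → ℂ, Admissible N Ψ ∧ normSq N Ω Ψ = 1 ∧ E = kinE N α Ω Ψ} :=
  ⟨0, by rintro E ⟨Ψ, _, _, rfl⟩; exact kinE_nonneg _ _ _ _⟩

theorem EN_nonneg (N : ℕ) (α : ℝ) : 0 ≤ EN N α := by
  unfold EN neumannE
  split_ifs
  · exact le_rfl
  · apply Real.sInf_nonneg
    rintro E ⟨Ψ, _, _, rfl⟩; exact kinE_nonneg _ _ _ _

theorem exists_normalized {N : ℕ} {Ψ : Config N → ℂ} (h : Admissible N Ψ) (h0 : 0 < normSq N Q0 Ψ) :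
    ∃ Φ, Admissible N Φ ∧ normSq N Q0 Φ = 1 ∧ ∀ α, kinE N α Q0 Φ = kinE N α Q0 Ψ / normSq N Q0 Ψ := by
  set c := (Real.sqrt (normSq N Q0 Ψ))⁻¹
  have hc : c ^ 2 = (normSq N Q0 Ψ)⁻¹ := by
    simp only [c, inv_pow, Real.sq_sqrt h0.le]
  refine ⟨_, h.const_mul c, ?_, fun α => ?_⟩
  · rw [normSq_const_mul, hc, inv_mul_cancel₀ h0.ne']
  · rw [kinE_const_mul h, hc]; field_simp

theorem EN_mul_le {N : ℕ} (hN : N ≠ 0) (α : ℝ) {Ψ : Config N → ℂ} (h : Admissible N Ψ) :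
    EN N α * normSq N Q0 Ψ ≤ kinE N α Q0 Ψ := by
  rcases (normSq_nonneg N Ψ Q0).eq_or_lt with h0 | h0
  · rw [← h0, mul_zero]; exact kinE_nonneg _ _ _ _
  · obtain ⟨Φ, h1, h2, h3⟩ := exists_normalized h h0
    rw [← le_div_iff₀ h0, ← h3]
    unfold EN neumannE
    rw [if_neg hN]
    exact csInf_le (bddBelow_E _ _ _) ⟨Φ, h1, h2, rfl⟩

/-! ### Gauge functions -/

/-- A smooth function equal to `1/t` away from `0`. -/
theorem exists_smooth_inv (δ : ℝ) (hδ : 0 < δ) :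
    ∃ g : ℝ → ℝ, ContDiff ℝ (⊤ : ℕ∞) g ∧ ∀ t, δ < |t| → g t = t⁻¹ := by
  refine ⟨fun t => t / (t ^ 2 + (1 - Real.smoothTransition ((t / δ) ^ 2))), ?_, ?_⟩
  · apply ContDiff.div contDiff_id
    · apply ContDiff.add (contDiff_id.pow 2)
      apply contDiff_const.sub
      exact Real.smoothTransition.contDiff.comp ((contDiff_id.div_const δ).pow 2)
    · intro t
      have h1 := Real.smoothTransition.le_one ((t / δ) ^ 2)
      rcases eq_or_ne t 0 with h | h
      · simp [h]
      · have : 0 < t ^ 2 := by positivity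
        linarith
  · intro t ht
    have h0 : t ≠ 0 := by rintro rfl; simp at ht; linarith
    have : 1 ≤ (t / δ) ^ 2 := by
      rw [div_pow, one_le_div (by positivity), ← sq_abs t]
      exact pow_le_pow_left₀ hδ.le ht.le 2
    simp only
    rw [Real.smoothTransition.one_of_one_le this]
    field_simp
    ring

/-- Open square with corner `c`, side `1/2`. -/
def Qs (c : Plane) : Set Plane := Ioo c.1 (c.1 + 1/2) ×ˢ Ioo c.2 (c.2 + 1/2)
/-- Closed square with corner `c`, side `1/2`. -/
def Qc (c : Plane) : Set Plane := Icc c.1 (c.1 + 1/2) ×ˢ Icc c.2 (c.2 + 1/2)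

theorem exists_gauge (c y : Plane) (hy : y ∉ Qc c) :
    ∃ θ : Plane → ℝ, ContDiff ℝ (⊤ : ℕ∞) θ ∧ ∀ x ∈ Qs c, ∀ v : Plane,
      fderiv ℝ θ x v = (perpInv (x - y)).1 * v.1 + (perpInv (x - y)).2 * v.2 := by
  have h : (∃ δ > 0, ∀ x ∈ Qs c, δ < |x.1 - y.1|) ∨ (∃ δ > 0, ∀ x ∈ Qs c, δ < |x.2 - y.2|) := by
    by_contra! hcon
    apply hy
    obtain ⟨h1, h2⟩ := hcon
    refine ⟨⟨?_, ?_⟩, ⟨?_, ?_⟩⟩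
    · by_contra! hlt
      obtain ⟨x, ⟨hx1, _⟩, hx⟩ := h1 (c.1 - y.1) (by linarith)
      linarith [le_abs_self (x.1 - y.1), hx1.1]
    · by_contra! hlt
      obtain ⟨x, ⟨hx1, _⟩, hx⟩ := h1 (y.1 - (c.1 + 1/2)) (by linarith)
      linarith [neg_le_abs (x.1 - y.1), hx1.2]
    · by_contra! hlt
      obtain ⟨x, ⟨_, hx1⟩, hx⟩ := h2 (c.2 - y.2) (by linarith)
      linarith [le_abs_self (x.2 - y.2), hx1.1]
    · by_contra! hlt
      obtain ⟨x, ⟨_, hx1⟩, hx⟩ := h2 (y.2 - (c.2 + 1/2)) (by linarith)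
      linarith [neg_le_abs (x.2 - y.2), hx1.2]
  rcases h with ⟨δ, hδ, hx⟩ | ⟨δ, hδ, hx⟩
  · obtain ⟨g, hg, hgt⟩ := exists_smooth_inv δ hδ
    refine ⟨fun x => Real.arctan ((x.2 - y.2) * g (x.1 - y.1)), ?_, ?_⟩
    · exact Real.contDiff_arctan.comp ((contDiff_snd.sub contDiff_const).mul (hg.comp (contDiff_fst.sub contDiff_const)))
    · intro x hxQ v
      have hd := hx x hxQ
      have hne : x.1 - y.1 ≠ 0 := by intro h; rw [h, abs_zero] at hd; linarith
      have hev : g =ᶠ[𝓝 (x.1 - y.1)] fun t => t⁻¹ := by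
        filter_upwards [(isOpen_lt continuous_const continuous_abs).mem_nhds hd] with t ht using hgt t ht
      have hgd : HasDerivAt g (-((x.1 - y.1) ^ 2)⁻¹) (x.1 - y.1) := (hasDerivAt_inv hne).congr_of_eventuallyEq hev
      have h1 : HasFDerivAt (fun x : Plane => x.1 - y.1) (ContinuousLinearMap.fst ℝ ℝ ℝ) x := hasFDerivAt_fst.sub_const _
      have h2 : HasFDerivAt (fun x : Plane => x.2 - y.2) (ContinuousLinearMap.snd ℝ ℝ ℝ) x := hasFDerivAt_snd.sub_const _
      have h3 := (h2.mul (hgd.comp_hasFDerivAt x h1)).arctan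
      have e := h3.fderiv
      simp only [Function.comp_def, Pi.mul_apply] at e
      rw [e]
      simp [perpInv, hgt _ hd]
      field_simp
      ring
  · obtain ⟨g, hg, hgt⟩ := exists_smooth_inv δ hδ
    refine ⟨fun x => -Real.arctan ((x.1 - y.1) * g (x.2 - y.2)), ?_, ?_⟩
    · exact (Real.contDiff_arctan.comp ((contDiff_fst.sub contDiff_const).mul (hg.comp (contDiff_snd.sub contDiff_const)))).neg
    · intro x hxQ v
      have hd := hx x hxQ
      have hne : x.2 - y.2 ≠ 0 := by intro h; rw [h, abs_zero] at hd; linarith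
      have hev : g =ᶠ[𝓝 (x.2 - y.2)] fun t => t⁻¹ := by
        filter_upwards [(isOpen_lt continuous_const continuous_abs).mem_nhds hd] with t ht using hgt t ht
      have hgd : HasDerivAt g (-((x.2 - y.2) ^ 2)⁻¹) (x.2 - y.2) := (hasDerivAt_inv hne).congr_of_eventuallyEq hev
      have h1 : HasFDerivAt (fun x : Plane => x.1 - y.1) (ContinuousLinearMap.fst ℝ ℝ ℝ) x := hasFDerivAt_fst.sub_const _
      have h2 : HasFDerivAt (fun x : Plane => x.2 - y.2) (ContinuousLinearMap.snd ℝ ℝ ℝ) x := hasFDerivAt_snd.sub_const _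
      have h3 := ((h1.mul (hgd.comp_hasFDerivAt x h2)).arctan).neg
      have e := h3.fderiv
      simp only [Function.comp_def, Pi.mul_apply] at e
      erw [e]
      simp [perpInv, hgt _ hd]
      field_simp
      ring

/-- Replace particles `J 0`, `J 1` of `x` by rescaled positions `c + z/2`. -/
def ins {N : ℕ} (J : Fin 2 → Fin N) (c : Plane) (x : Config N) (z : Config 2) : Config N :=
  fun i => if i = J 0 then c + (1/2 : ℝ) • z 0 else if i = J 1 then c + (1/2 : ℝ) • z 1 else x i

theorem ins_J {N : ℕ} {J : Fin 2 → Fin N} (hJ : J 0 ≠ J 1) (c : Plane) (x : Config N) (z : Config 2) (a : Fin 2) :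
    ins J c x z (J a) = c + (1/2 : ℝ) • z a := by
  fin_cases a
  · simp [ins]
  · simp [ins, hJ.symm]

theorem ins_other {N : ℕ} {J : Fin 2 → Fin N} (c : Plane) (x : Config N) (z : Config 2) {i : Fin N}
    (h0 : i ≠ J 0) (h1 : i ≠ J 1) : ins J c x z i = x i := by
  simp [ins, h0, h1]

theorem contDiff_ins {N : ℕ} (J : Fin 2 → Fin N) (c : Plane) (x : Config N) :
    ContDiff ℝ (⊤ : ℕ∞) (ins J c x) := by
  rw [contDiff_pi]
  intro i
  unfold ins
  split_ifs <;> fun_prop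

theorem fderiv_ins {N : ℕ} {J : Fin 2 → Fin N} (hJ : J 0 ≠ J 1) (c : Plane) (x : Config N) (z : Config 2)
    (a : Fin 2) (v : Plane) :
    fderiv ℝ (ins J c x) z (Pi.single a v) = Pi.single (J a) ((1/2 : ℝ) • v) := by
  have hd : DifferentiableAt ℝ (ins J c x) z := (contDiff_ins J c x).differentiable (by simp) z
  ext i : 1
  have : fderiv ℝ (ins J c x) z (Pi.single a v) i = fderiv ℝ (fun z => ins J c x z i) z (Pi.single a v) := by
    rw [fderiv_apply (hd.hasFDerivAt.differentiableAt) i]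
    simp
  rw [this]
  have hp : ∀ b : Fin 2, fderiv ℝ (fun z : Config 2 => c + (1/2 : ℝ) • z b) z (Pi.single a v) = (1/2 : ℝ) • (Pi.single a v : Config 2) b := by
    intro b
    have h := ((hasFDerivAt_apply (𝕜 := ℝ) (F' := fun _ : Fin 2 => Plane) b z).const_smul (1/2 : ℝ)).const_add c
    have e := h.fderiv
    erw [e]
    simp
  by_cases h0 : i = J 0
  · subst h0
    simp only [ins, if_true]
    rw [hp]
    fin_cases a
    · simp
    · simp [hJ]
  · by_cases h1 : i = J 1
    · subst h1
      simp only [ins, if_true, if_neg h0]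
      rw [hp]
      fin_cases a
      · simp [hJ.symm]
      · simp
    · simp only [ins, if_neg h0, if_neg h1]
      fin_cases a
      · simp [h0]
      · simp [h1]

theorem perpInv_half (v : Plane) : perpInv ((1/2 : ℝ) • v) = (2 : ℝ) • perpInv v := by
  rcases eq_or_ne v 0 with rfl | hv
  · simp [perpInv]
  · have := (sq_add_sq_pos hv).ne'
    ext
    · simp [perpInv]; field_simp
    · simp [perpInv]; field_simp

theorem abPot_ins {N : ℕ} {J : Fin 2 → Fin N} (hJ : J 0 ≠ J 1) (c : Plane) (x : Config N) (z : Config 2) (a : Fin 2) :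
    abPot N (J a) (ins J c x z) = (2 : ℝ) • abPot 2 a z +
      ∑ l ∈ (Finset.univ.erase (J 0)).erase (J 1), perpInv (c + (1/2 : ℝ) • z a - x l) := by
  unfold abPot
  have hs : ∀ y : Plane, ∑ l ∈ (Finset.univ.erase (J 0)).erase (J 1), perpInv (y - ins J c x z l) =
      ∑ l ∈ (Finset.univ.erase (J 0)).erase (J 1), perpInv (y - x l) := by
    intro y
    refine Finset.sum_congr rfl fun l hl => ?_
    simp only [Finset.mem_erase, Finset.mem_univ, and_true] at hl
    rw [ins_other c x z hl.2 hl.1]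
  have hsc : ∀ p q : Plane, c + (1/2 : ℝ) • p - (c + (1/2 : ℝ) • q) = (1/2 : ℝ) • (p - q) := by
    intro p q; rw [smul_sub]; abel
  have u0 : (Finset.univ : Finset (Fin 2)).erase 0 = {1} := by decide
  have u1 : (Finset.univ : Finset (Fin 2)).erase 1 = {0} := by decide
  fin_cases a
  · simp only [Fin.zero_eta]
    rw [← Finset.add_sum_erase (Finset.univ.erase (J 0)) _ (a := J 1) (by simp [hJ.symm]), hs, ins_J hJ, ins_J hJ, hsc,
      perpInv_half, u0, Finset.sum_singleton]
  · simp only [Fin.mk_one]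
    rw [← Finset.add_sum_erase (Finset.univ.erase (J 1)) _ (a := J 0) (by simp [hJ]), Finset.erase_right_comm, hs, ins_J hJ, ins_J hJ, hsc,
      perpInv_half, u1, Finset.sum_singleton]

/-- Gauge-transformed two-particle function. -/
def Phi {N : ℕ} (J : Fin 2 → Fin N) (c : Plane) (x : Config N) (α : ℝ) (θ : Plane → ℝ) (Ψ : Config N → ℂ)
    (z : Config 2) : ℂ :=
  Ψ (ins J c x z) * Complex.exp (((α * (θ (c + (1/2 : ℝ) • z 0) + θ (c + (1/2 : ℝ) • z 1)) : ℝ) : ℂ) * Complex.I)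

theorem norm_Phi {N : ℕ} (J : Fin 2 → Fin N) (c : Plane) (x : Config N) (α : ℝ) (θ : Plane → ℝ) (Ψ : Config N → ℂ)
    (z : Config 2) : ‖Phi J c x α θ Ψ z‖ = ‖Ψ (ins J c x z)‖ := by
  rw [Phi, norm_mul, Complex.norm_exp_ofReal_mul_I, mul_one]

theorem admissible_Phi {N : ℕ} {J : Fin 2 → Fin N} (hJ : J 0 ≠ J 1) (c : Plane) (x : Config N) (α : ℝ) (θ : Plane → ℝ)
    (hθ : ContDiff ℝ (⊤ : ℕ∞) θ) {Ψ : Config N → ℂ} (h : Admissible N Ψ) : Admissible 2 (Phi J c x α θ Ψ) where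
  smooth := by
    unfold Phi
    apply (h.smooth.comp (contDiff_ins J c x)).mul
    apply ContDiff.cexp
    apply ContDiff.mul _ contDiff_const
    apply Complex.ofRealCLM.contDiff.comp
    apply contDiff_const.mul
    exact (hθ.comp (by fun_prop)).add (hθ.comp (by fun_prop))
  symm σ z := by
    have hσ : σ = 1 ∨ σ = Equiv.swap 0 1 := by
      revert σ; decide
    rcases hσ with rfl | rfl
    · rfl
    · have e : ins J c x (z ∘ (Equiv.swap 0 1)) = ins J c x z ∘ (Equiv.swap (J 0) (J 1)) := by
        ext i : 1
        by_cases h0 : i = J 0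
        · subst h0; simp [ins, hJ.symm]
        · by_cases h1 : i = J 1
          · subst h1; simp [ins, hJ.symm]
          · simp [ins, h0, h1, Equiv.swap_apply_of_ne_of_ne h0 h1]
      unfold Phi
      rw [e, h.symm]
      simp only [Function.comp_apply, Equiv.swap_apply_left, Equiv.swap_apply_right]
      rw [add_comm (θ _)]
  vanishes := by
    obtain ⟨U, h1, h2, h3⟩ := h.vanishes
    refine ⟨ins J c x ⁻¹' U, h1.preimage (contDiff_ins J c x).continuous, ?_, ?_⟩
    · rintro z ⟨a, b, hab, e⟩
      apply h2
      refine ⟨J a, J b, ?_, by rw [ins_J hJ, ins_J hJ, e]⟩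
      fin_cases a <;> fin_cases b <;> simp_all [hJ.symm]
    · intro z hz
      simp [Phi, h3 _ hz]

theorem DSq_Phi {N : ℕ} {J : Fin 2 → Fin N} (hJ : J 0 ≠ J 1) (c : Plane) (x : Config N) (α : ℝ) (θ : Plane → ℝ)
    (hθ : ContDiff ℝ (⊤ : ℕ∞) θ) {Ψ : Config N → ℂ} (h : Admissible N Ψ) (z : Config 2) (a : Fin 2)
    (hg : ∀ v : Plane, fderiv ℝ θ (c + (1/2 : ℝ) • z a) v =
      (∑ l ∈ (Finset.univ.erase (J 0)).erase (J 1), perpInv (c + (1/2 : ℝ) • z a - x l)).1 * v.1 +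
      (∑ l ∈ (Finset.univ.erase (J 0)).erase (J 1), perpInv (c + (1/2 : ℝ) • z a - x l)).2 * v.2) :
    DSq 2 α a (Phi J c x α θ Ψ) z = 1/4 * DSq N α (J a) Ψ (ins J c x z) := by
  set B := ∑ l ∈ (Finset.univ.erase (J 0)).erase (J 1), perpInv (c + (1/2 : ℝ) • z a - x l)
  have hA : abPot N (J a) (ins J c x z) = (2 : ℝ) • abPot 2 a z + B := abPot_ins hJ c x z a
  set E := Complex.exp (((α * (θ (c + (1/2 : ℝ) • z 0) + θ (c + (1/2 : ℝ) • z 1)) : ℝ) : ℂ) * Complex.I) with hE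
  have hEn : ‖E‖ = 1 := Complex.norm_exp_ofReal_mul_I _
  have hdθ : ∀ y, HasFDerivAt θ (fderiv ℝ θ y) y := fun y => (hθ.differentiable (by simp) y).hasFDerivAt
  have hp : ∀ b : Fin 2, HasFDerivAt (fun z : Config 2 => c + (1/2 : ℝ) • z b) ((1/2 : ℝ) • ContinuousLinearMap.proj (R := ℝ) b) z := 
    fun b => ((hasFDerivAt_apply (𝕜 := ℝ) (F' := fun _ : Fin 2 => Plane) b z).const_smul (1/2 : ℝ)).const_add c
  have hΨ : HasFDerivAt (fun z => Ψ (ins J c x z)) _ z :=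
    (h.smooth.differentiable (by simp) (ins J c x z)).hasFDerivAt.comp z ((contDiff_ins J c x).differentiable (by simp) z).hasFDerivAt
  have ht : HasFDerivAt (fun z : Config 2 => α * (θ (c + (1/2 : ℝ) • z 0) + θ (c + (1/2 : ℝ) • z 1))) _ z :=
    (((hdθ _).comp z (hp 0)).add ((hdθ _).comp z (hp 1))).const_mul α
  have hex := ((Complex.ofRealCLM.hasFDerivAt.comp z ht).mul_const Complex.I).cexp
  have hPhi : HasFDerivAt (Phi J c x α θ Ψ) _ z := hΨ.mul hex
  have hpd : ∀ v, fderiv ℝ (Phi J c x α θ Ψ) z (Pi.single a v) =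
      E * (fderiv ℝ Ψ (ins J c x z) (Pi.single (J a) ((1/2 : ℝ) • v)) + Ψ (ins J c x z) * ((α * ((1/2 : ℝ) * (B.1 * v.1 + B.2 * v.2)) : ℝ) : ℂ) * Complex.I) := by
    intro v
    rw [hPhi.fderiv, ← hg v]
    simp only [_root_.add_apply, _root_.smul_apply, ContinuousLinearMap.comp_apply, fderiv_ins hJ, smul_eq_mul]
    change Ψ (ins J c x z) * (E * _) + E * _ = _
    fin_cases a
    · simp
      ring
    · simp
      ring
  have hP : Phi J c x α θ Ψ z = E * Ψ (ins J c x z) := by rw [Phi, mul_comm]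
  have hsm : ∀ v : Plane, fderiv ℝ Ψ (ins J c x z) (Pi.single (J a) ((1/2 : ℝ) • v)) = (1/2 : ℂ) * fderiv ℝ Ψ (ins J c x z) (Pi.single (J a) v) := by
    intro v
    rw [Pi.single_smul, map_smul]
    simp
  have e1 : (DOp 2 α a (Phi J c x α θ Ψ) z).1 = E * (1/2) * (DOp N α (J a) Ψ (ins J c x z)).1 := by
    simp only [DOp, pder, hpd, hsm, hP, hA, Prod.fst_add, Prod.smul_fst]
    push_cast
    simp
    ring_nf
    simp
    ring
  have e2 : (DOp 2 α a (Phi J c x α θ Ψ) z).2 = E * (1/2) * (DOp N α (J a) Ψ (ins J c x z)).2 := by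
    simp only [DOp, pder, hpd, hsm, hP, hA, Prod.snd_add, Prod.smul_snd]
    push_cast
    simp
    ring_nf
    simp
    ring
  unfold DSq
  rw [e1, e2]
  simp only [norm_mul, hEn]
  norm_num
  ring

def tS {N : ℕ} (J : Fin 2 → Fin N) (c : Plane) (i : Fin N) : Set Plane :=
  if i = J 0 ∨ i = J 1 then Qs c else Q0 \ Qc c
def tX {N : ℕ} (J : Fin 2 → Fin N) (c : Plane) (i : Fin N) : Set Plane :=
  if i = J 0 ∨ i = J 1 then Q0 else Q0 \ Qc c
/-- Configurations where exactly the particles `J 0`, `J 1` are in the square `Qs c`. -/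
def SS {N : ℕ} (J : Fin 2 → Fin N) (c : Plane) : Set (Config N) := Set.univ.pi (tS J c)
def SX {N : ℕ} (J : Fin 2 → Fin N) (c : Plane) : Set (Config N) := Set.univ.pi (tX J c)

theorem measurableSet_Qs (c : Plane) : MeasurableSet (Qs c) := measurableSet_Ioo.prod measurableSet_Ioo
theorem measurableSet_Qc (c : Plane) : MeasurableSet (Qc c) := measurableSet_Icc.prod measurableSet_Icc
theorem measurableSet_tS {N : ℕ} (J : Fin 2 → Fin N) (c : Plane) (i : Fin N) : MeasurableSet (tS J c i) := by
  unfold tS; split_ifs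
  · exact measurableSet_Qs c
  · exact measurableSet_Q0.diff (measurableSet_Qc c)
theorem measurableSet_tX {N : ℕ} (J : Fin 2 → Fin N) (c : Plane) (i : Fin N) : MeasurableSet (tX J c i) := by
  unfold tX; split_ifs
  · exact measurableSet_Q0
  · exact measurableSet_Q0.diff (measurableSet_Qc c)
theorem measurableSet_SS {N : ℕ} (J : Fin 2 → Fin N) (c : Plane) : MeasurableSet (SS J c) :=
  MeasurableSet.univ_pi (measurableSet_tS J c)
theorem measurableSet_SX {N : ℕ} (J : Fin 2 → Fin N) (c : Plane) : MeasurableSet (SX J c) :=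
  MeasurableSet.univ_pi (measurableSet_tX J c)

theorem Q0_preimage (c : Plane) : (fun z : Plane => c + (1/2 : ℝ) • z) ⁻¹' (Qs c) = Q0 := by
  ext z
  simp only [Qs, Q0, mem_preimage, mem_prod, mem_Ioo, Prod.fst_add, Prod.snd_add, Prod.smul_fst, Prod.smul_snd, smul_eq_mul]
  constructor
  · rintro ⟨⟨a, b⟩, c, d⟩; refine ⟨⟨?_, ?_⟩, ?_, ?_⟩ <;> linarith
  · rintro ⟨⟨a, b⟩, c, d⟩; refine ⟨⟨?_, ?_⟩, ?_, ?_⟩ <;> linarith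

theorem volume_scale (c : Plane) (s : Set Plane) :
    volume ((fun z : Plane => c + (1/2 : ℝ) • z) ⁻¹' s) = 4 * volume s := by
  have : (fun z : Plane => c + (1/2 : ℝ) • z) ⁻¹' s = ((1/2 : ℝ) • ·) ⁻¹' ((c + ·) ⁻¹' s) := rfl
  rw [this, Measure.addHaar_preimage_smul _ (by norm_num), measure_preimage_add]
  congr 1
  simp
  norm_num

theorem prod_split {N : ℕ} {J : Fin 2 → Fin N} (hJ : J 0 ≠ J 1) (f : Fin N → ENNReal) :
    ∏ i, f i = f (J 0) * (f (J 1) * ∏ i ∈ (Finset.univ.erase (J 0)).erase (J 1), f i) := by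
  rw [← Finset.mul_prod_erase Finset.univ f (Finset.mem_univ (J 0)),
    ← Finset.mul_prod_erase (Finset.univ.erase (J 0)) f (a := J 1) (by simp [hJ.symm])]

theorem continuous_ins {N : ℕ} (J : Fin 2 → Fin N) (c : Plane) :
    Continuous (fun p : Config N × Config 2 => ins J c p.1 p.2) := by
  apply continuous_pi
  intro i
  unfold ins
  split_ifs <;> fun_prop

theorem map_ins {N : ℕ} {J : Fin 2 → Fin N} (hJ : J 0 ≠ J 1) (c : Plane) :
    (volume : Measure (Config N)).restrict (SS J c) = (16 : ENNReal)⁻¹ •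
     Measure.map (fun p : Config N × Config 2 => ins J c p.1 p.2)
      ((volume.restrict (SX J c)).prod (volume.restrict (cube 2 Q0))) := by
  have hm := (continuous_ins J c).measurable
  rw [SS, volume_pi, Measure.restrict_pi_pi]
  apply Measure.pi_eq
  intro s hs
  rw [Measure.smul_apply, Measure.map_apply hm (MeasurableSet.univ_pi hs)]
  have e : (fun p : Config N × Config 2 => ins J c p.1 p.2) ⁻¹' (univ.pi s) =
      (univ.pi fun i => if i = J 0 ∨ i = J 1 then univ else s i) ×ˢ
      (univ.pi fun a => (fun z : Plane => c + (1/2 : ℝ) • z) ⁻¹' (s (J a))) := by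
    ext ⟨x, z⟩
    simp only [mem_preimage, mem_prod, mem_univ_pi]
    constructor
    · intro h
      refine ⟨fun i => ?_, fun a => ?_⟩
      · split_ifs with hi
        · trivial
        · push Not at hi
          have := h i
          rwa [ins_other c x z hi.1 hi.2] at this
      · have := h (J a)
        rwa [ins_J hJ] at this
    · rintro ⟨h1, h2⟩ i
      by_cases h0 : i = J 0
      · subst h0; rw [ins_J hJ]; exact h2 0
      · by_cases h0' : i = J 1
        · subst h0'; rw [ins_J hJ]; exact h2 1
        · rw [ins_other c x z h0 h0']
          have := h1 i
          rwa [if_neg (by tauto)] at this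
  rw [e, Measure.prod_prod]
  have hA : MeasurableSet (univ.pi fun i => if i = J 0 ∨ i = J 1 then univ else s i) :=
    MeasurableSet.univ_pi fun i => by split_ifs; exacts [MeasurableSet.univ, hs i]
  have haff : Measurable (fun z : Plane => c + (1/2 : ℝ) • z) := by fun_prop
  have hB : MeasurableSet (univ.pi fun a => (fun z : Plane => c + (1/2 : ℝ) • z) ⁻¹' (s (J a))) :=
    MeasurableSet.univ_pi fun i => haff (hs _)
  rw [Measure.restrict_apply hA, Measure.restrict_apply hB, SX, cube, ← pi_inter_distrib, ← pi_inter_distrib]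
  rw [← volume_pi, volume_pi_pi, volume_pi_pi, Fin.prod_univ_two]
  have hq : ∀ a, volume ((fun z : Plane => c + (1/2 : ℝ) • z) ⁻¹' (s (J a)) ∩ Q0) = 4 * volume (s (J a) ∩ Qs c) := by
    intro a
    rw [← volume_scale c, preimage_inter, Q0_preimage]
  rw [hq, hq, prod_split hJ, prod_split hJ]
  have t0 : tS J c (J 0) = Qs c := by simp [tS]
  have t1 : tS J c (J 1) = Qs c := by simp [tS]
  have x0 : tX J c (J 0) = Q0 := by simp [tX]
  have x1 : tX J c (J 1) = Q0 := by simp [tX]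
  simp only [t0, t1, x0, x1, Measure.restrict_apply (hs _), true_or, or_true, if_true, univ_inter, volume_Q0, one_mul]
  have hr : ∏ i ∈ (Finset.univ.erase (J 0)).erase (J 1), volume ((if i = J 0 ∨ i = J 1 then univ else s i) ∩ tX J c i) =
     ∏ i ∈ (Finset.univ.erase (J 0)).erase (J 1), volume (s i ∩ tS J c i) := by
    refine Finset.prod_congr rfl fun i hi => ?_
    simp only [Finset.mem_erase, Finset.mem_univ, and_true] at hi
    have : ¬ (i = J 0 ∨ i = J 1) := by tauto
    simp [tS, tX, this]
  rw [hr]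
  generalize volume (s (J 0) ∩ Qs c) = a
  generalize volume (s (J 1) ∩ Qs c) = b
  generalize (∏ i ∈ (Finset.univ.erase (J 0)).erase (J 1), volume (s i ∩ tS J c i)) = d
  have h16 : (16 : ENNReal)⁻¹ * 16 = 1 := ENNReal.inv_mul_cancel (by norm_num) (by norm_num)
  calc (16 : ENNReal)⁻¹ • (d * (4 * a * (4 * b))) = ((16 : ENNReal)⁻¹ * 16) * (a * (b * d)) := by
        rw [smul_eq_mul]; ring
    _ = _ := by rw [h16, one_mul]

theorem SS_subset {N : ℕ} (J : Fin 2 → Fin N) (c : Plane) (hc : Qs c ⊆ Q0) : SS J c ⊆ cube N Q0 := by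
  apply Set.pi_mono
  intro i _
  unfold tS
  split_ifs
  · exact hc
  · exact sdiff_subset

theorem integral_SS {N : ℕ} {J : Fin 2 → Fin N} (hJ : J 0 ≠ J 1) (c : Plane) (hc : Qs c ⊆ Q0) (f : Config N → ℝ) (hf : Continuous f) :
    IntegrableOn (fun x => ∫ z in cube 2 Q0, f (ins J c x z)) (SX J c) ∧
    ∫ x in SS J c, f x = 1/16 * ∫ x in SX J c, ∫ z in cube 2 Q0, f (ins J c x z) := by
  have hi : IntegrableOn f (SS J c) := (integrableOn_cube hf).mono_set (SS_subset J c hc)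
  have hm := (continuous_ins J c).measurable
  have h16 : (16 : ENNReal)⁻¹ ≠ 0 := by simp
  unfold IntegrableOn at hi
  rw [map_ins hJ c] at hi ⊢
  rw [integrable_smul_measure h16 (by simp), integrable_map_measure hf.aestronglyMeasurable hm.aemeasurable] at hi
  refine ⟨hi.integral_prod_left, ?_⟩
  rw [integral_smul_measure, integral_map hm.aemeasurable hf.aestronglyMeasurable, integral_prod (fun p : Config N × Config 2 => f (ins J c p.1 p.2)) hi]
  simp

/-- Local two-particle bound. -/
theorem local_bound {N : ℕ} {J : Fin 2 → Fin N} (hJ : J 0 ≠ J 1) (c : Plane) (hc : Qs c ⊆ Q0) (α : ℝ) {Ψ : Config N → ℂ}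
    (h : Admissible N Ψ) :
    4 * EN 2 α * ∫ x in SS J c, ‖Ψ x‖ ^ 2 ≤ ∫ x in SS J c, (DSq N α (J 0) Ψ x + DSq N α (J 1) Ψ x) := by
  have hΨ := h.smooth.continuous
  have hD := h.continuous_DSq α
  obtain ⟨i1, e1⟩ := integral_SS hJ c hc (fun x => ‖Ψ x‖ ^ 2) (by fun_prop)
  obtain ⟨i2, e2⟩ := integral_SS hJ c hc (fun x => DSq N α (J 0) Ψ x + DSq N α (J 1) Ψ x) (by fun_prop)
  rw [e1, e2]
  have key : ∀ x ∈ SX J c, 4 * EN 2 α * ∫ z in cube 2 Q0, ‖Ψ (ins J c x z)‖ ^ 2 ≤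
      ∫ z in cube 2 Q0, (DSq N α (J 0) Ψ (ins J c x z) + DSq N α (J 1) Ψ (ins J c x z)) := by
    intro x hx
    have hg : ∀ l, ∃ θ : Plane → ℝ, l ∈ (Finset.univ.erase (J 0)).erase (J 1) → ContDiff ℝ (⊤ : ℕ∞) θ ∧ ∀ y ∈ Qs c, ∀ v : Plane,
      fderiv ℝ θ y v = (perpInv (y - x l)).1 * v.1 + (perpInv (y - x l)).2 * v.2 := by
      intro l
      by_cases hl : l ∈ (Finset.univ.erase (J 0)).erase (J 1)
      · have : x l ∉ Qc c := by
          simp only [Finset.mem_erase, Finset.mem_univ, and_true] at hl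
          have h2 := hx l (mem_univ l)
          rw [tX, if_neg (by tauto)] at h2
          exact h2.2
        obtain ⟨θ, h1⟩ := exists_gauge c (x l) this
        exact ⟨θ, fun _ => h1⟩
      · exact ⟨0, fun h => absurd h hl⟩
    choose θ hθ using hg
    set Θ : Plane → ℝ := fun y => ∑ l ∈ (Finset.univ.erase (J 0)).erase (J 1), θ l y with hΘ
    have hΘc : ContDiff ℝ (⊤ : ℕ∞) Θ := ContDiff.sum fun l hl => (hθ l hl).1
    have hΘd : ∀ y ∈ Qs c, ∀ v : Plane, fderiv ℝ Θ y v = 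
      (∑ l ∈ (Finset.univ.erase (J 0)).erase (J 1), perpInv (y - x l)).1 * v.1 +
      (∑ l ∈ (Finset.univ.erase (J 0)).erase (J 1), perpInv (y - x l)).2 * v.2 := by
      intro y hy v
      rw [hΘ, fderiv_fun_sum fun l hl => (hθ l hl).1.differentiable (by simp) y]
      rw [_root_.sum_apply, Prod.fst_sum, Prod.snd_sum, Finset.sum_mul, Finset.sum_mul, ← Finset.sum_add_distrib]
      exact Finset.sum_congr rfl fun l hl => (hθ l hl).2 y hy v
    have hadm := admissible_Phi hJ c x α Θ hΘc h
    have hE := EN_mul_le (two_ne_zero) α hadm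
    rw [kinE_eq hadm] at hE
    have en : normSq 2 Q0 (Phi J c x α Θ Ψ) = ∫ z in cube 2 Q0, ‖Ψ (ins J c x z)‖ ^ 2 := by
      simp only [normSq, norm_Phi]
    have ek : ∫ z in cube 2 Q0, ∑ a, DSq 2 α a (Phi J c x α Θ Ψ) z = 
       1/4 * ∫ z in cube 2 Q0, (DSq N α (J 0) Ψ (ins J c x z) + DSq N α (J 1) Ψ (ins J c x z)) := by
      rw [← integral_const_mul]
      apply setIntegral_congr_fun (measurableSet_cube 2)
      intro z hz
      have hz' : ∀ a, c + (1/2 : ℝ) • z a ∈ Qs c := by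
        intro a
        have h1 : z a ∈ Q0 := hz a (mem_univ a)
        rw [← Q0_preimage c] at h1
        exact h1
      simp only [Fin.sum_univ_two]
      rw [DSq_Phi hJ c x α Θ hΘc h z 0 (hΘd _ (hz' 0)), DSq_Phi hJ c x α Θ hΘc h z 1 (hΘd _ (hz' 1))]
      ring
    rw [en, ek] at hE
    linarith
  have := setIntegral_mono_on (i1.const_mul (4 * EN 2 α)) i2 (measurableSet_SX J c) key
  rw [integral_const_mul] at this
  linarith

theorem integral_poly4 (a0 a1 a2 a3 a4 : ℝ) :
    ∫ t in Ioo (0:ℝ) 1, (a0 + a1 * t + a2 * t ^ 2 + a3 * t ^ 3 + a4 * t ^ 4) =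
      a0 + a1 / 2 + a2 / 3 + a3 / 4 + a4 / 5 := by
  rw [← integral_Ioc_eq_integral_Ioo, ← intervalIntegral.integral_of_le zero_le_one]
  have hi : ∀ f : ℝ → ℝ, Continuous f → IntervalIntegrable f volume 0 1 :=
    fun f hf => hf.intervalIntegrable 0 1
  rw [intervalIntegral.integral_add (hi _ (by fun_prop)) (hi _ (by fun_prop)),
    intervalIntegral.integral_add (hi _ (by fun_prop)) (hi _ (by fun_prop)),
    intervalIntegral.integral_add (hi _ (by fun_prop)) (hi _ (by fun_prop)),
    intervalIntegral.integral_add (hi _ (by fun_prop)) (hi _ (by fun_prop))]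
  have hid : ∫ x in (0:ℝ)..1, a1 * x = a1 / 2 := by
    rw [intervalIntegral.integral_const_mul, integral_id]; norm_num; ring
  rw [hid]
  simp only [intervalIntegral.integral_const_mul, integral_pow,
    intervalIntegral.integral_const]
  norm_num
  ring

theorem integral_poly4' {f : ℝ → ℝ} (a0 a1 a2 a3 a4 : ℝ)
    (hf : ∀ t, f t = a0 + a1 * t + a2 * t ^ 2 + a3 * t ^ 3 + a4 * t ^ 4) :
    ∫ t in Ioo (0:ℝ) 1, f t = a0 + a1 / 2 + a2 / 3 + a3 / 4 + a4 / 5 := by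
  rw [← integral_poly4]
  exact integral_congr_ae (Filter.Eventually.of_forall hf)

theorem integrable_Q0 {f : Plane → ℝ} (hf : Continuous f) : IntegrableOn f Q0 := by
  have : IsCompact (Icc (0:ℝ) 1 ×ˢ Icc (0:ℝ) 1) := isCompact_Icc.prod isCompact_Icc
  exact (hf.continuousOn.integrableOn_compact this).mono_set
    (prod_mono Ioo_subset_Icc_self Ioo_subset_Icc_self)

theorem integral_Q0 {f : Plane → ℝ} (hf : Continuous f) :
    ∫ p in Q0, f p = ∫ s in Ioo (0:ℝ) 1, ∫ t in Ioo (0:ℝ) 1, f (s, t) := by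
  have h := integrable_Q0 hf
  unfold IntegrableOn at h
  rw [Q0_eq] at h ⊢
  exact integral_prod _ h

/-- squared distance of the two particles -/
def rr (z : Config 2) : ℝ := ((z 0).1 - (z 1).1) ^ 2 + ((z 0).2 - (z 1).2) ^ 2

theorem rr_nonneg (z : Config 2) : 0 ≤ rr z := by unfold rr; positivity

theorem contDiff_rr {n : WithTop ℕ∞} : ContDiff ℝ n rr := by unfold rr; fun_prop

theorem integral_trial : ∫ z in cube 2 Q0, (10 * rr z - 18 * rr z ^ 2) = -1 / 15 := by
  have e := (volume_preserving_finTwoArrow Plane).symm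
  have hpre : (MeasurableEquiv.finTwoArrow (α := Plane)).symm ⁻¹' (cube 2 Q0) = Q0 ×ˢ Q0 := by
    ext p
    simp [cube, MeasurableEquiv.finTwoArrow]
  have h1 := e.setIntegral_preimage_emb (MeasurableEquiv.measurableEmbedding _)
    (fun z => 10 * rr z - 18 * rr z ^ 2) (cube 2 Q0)
  rw [← h1, hpre]
  have h2 : ∀ p : Plane × Plane, rr ((MeasurableEquiv.finTwoArrow (α := Plane)).symm p)
      = (p.1.1 - p.2.1) ^ 2 + (p.1.2 - p.2.2) ^ 2 := by
    intro p; simp [rr, MeasurableEquiv.finTwoArrow]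
  simp only [h2]
  rw [show (volume : Measure (Plane × Plane)) = volume.prod volume from rfl, setIntegral_prod]
  · have h3 : ∀ p : Plane, ∫ q in Q0, (10 * ((p.1 - q.1) ^ 2 + (p.2 - q.2) ^ 2)
        - 18 * ((p.1 - q.1) ^ 2 + (p.2 - q.2) ^ 2) ^ 2) =
        10 * ((p.1^2 - p.1 + 1/3) + (p.2^2 - p.2 + 1/3))
        - 18 * ((p.1^4-2*p.1^3+2*p.1^2-p.1+1/5) + 2 * (p.1^2 - p.1 + 1/3) * (p.2^2 - p.2 + 1/3)
          + (p.2^4-2*p.2^3+2*p.2^2-p.2+1/5)) := by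
      intro p
      rw [integral_Q0 (by fun_prop)]
      have h4 : ∀ a : ℝ, ∫ b in Ioo (0:ℝ) 1, (10 * ((p.1 - a) ^ 2 + (p.2 - b) ^ 2)
        - 18 * ((p.1 - a) ^ 2 + (p.2 - b) ^ 2) ^ 2) = 10 * ((p.1 - a)^2 + (p.2^2 - p.2 + 1/3))
          - 18 * ((p.1 - a)^4 + 2 * (p.1 - a)^2 * (p.2^2 - p.2 + 1/3)
          + (p.2^4-2*p.2^3+2*p.2^2-p.2+1/5)) := by
        intro a
        rw [integral_poly4' (10 * ((p.1 - a) ^ 2 + p.2^2) - 18 * ((p.1 - a) ^ 2 + p.2^2)^2)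
          (-20 * p.2 + 72 * ((p.1 - a) ^ 2 + p.2^2) * p.2)
          (10 - 36 * ((p.1 - a) ^ 2 + p.2^2) - 72 * p.2^2) (72 * p.2) (-18) (fun t => by ring)]
        ring
      simp only [h4]
      rw [integral_poly4' (10 * (p.1^2 + (p.2^2 - p.2 + 1/3)) - 18 * (p.1^4 + 2 * p.1^2 * (p.2^2 - p.2 + 1/3)
          + (p.2^4-2*p.2^3+2*p.2^2-p.2+1/5)))
          (-20 * p.1 + 72 * p.1 ^3 + 72 * p.1 * (p.2^2 - p.2 + 1/3))
          (10 - 108 * p.1^2 - 36 * (p.2^2 - p.2 + 1/3)) (72 * p.1) (-18) (fun t => by ring)]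
      ring
    simp only [h3]
    rw [integral_Q0 (by fun_prop)]
    have h5 : ∀ c : ℝ, ∫ d in Ioo (0:ℝ) 1, (10 * ((c^2 - c + 1/3) + (d^2 - d + 1/3))
        - 18 * ((c^4-2*c^3+2*c^2-c+1/5) + 2 * (c^2 - c + 1/3) * (d^2 - d + 1/3)
          + (d^4-2*d^3+2*d^2-d+1/5))) = 10 * ((c^2 - c + 1/3) + 1/6) 
          - 18 * ((c^4-2*c^3+2*c^2-c+1/5) + (c^2 - c + 1/3)/3 + 1/15) := by
      intro c
      rw [integral_poly4' (10 * ((c^2 - c + 1/3) + 1/3) - 18 * ((c^4-2*c^3+2*c^2-c+1/5) + 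
        2 * (c^2 - c + 1/3) / 3 + 1/5)) (-10 + 36 * (c^2 - c + 1/3) + 18) 
        (10 - 36 * (c^2 - c + 1/3) - 36) 36 (-18) (fun t => by ring)]
      ring
    simp only [h5]
    rw [integral_poly4' (10 * (1/3+1/6) - 18 * (1/5+1/9+1/15)) (-10+18+6) (10-36-6) 36 (-18) (fun t => by ring)]
    norm_num
  · have hK : IsCompact ((Icc (0:ℝ) 1 ×ˢ Icc (0:ℝ) 1) ×ˢ (Icc (0:ℝ) 1 ×ˢ Icc (0:ℝ) 1)) :=
      (isCompact_Icc.prod isCompact_Icc).prod (isCompact_Icc.prod isCompact_Icc)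
    have hs : Q0 ⊆ (Icc (0:ℝ) 1 ×ˢ Icc (0:ℝ) 1) := prod_mono Ioo_subset_Icc_self Ioo_subset_Icc_self
    refine (Continuous.continuousOn ?_ |>.integrableOn_compact hK).mono_set (prod_mono hs hs)
    fun_prop

/-- derivative profile -/
def gg (t : ℝ) : ℝ := smoothTransition (t - 1) + t * deriv smoothTransition (t - 1)

theorem continuous_gg : Continuous gg := by
  have h : Continuous (deriv smoothTransition) :=
    (smoothTransition.contDiff (n := 1)).continuous_deriv le_rfl
  have h2 := smoothTransition.continuous
  unfold gg
  fun_prop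

theorem gg_eq_one {t : ℝ} (ht : 2 < t) : gg t = 1 := by
  have e : smoothTransition =ᶠ[𝓝 (t - 1)] fun _ => 1 := by
    filter_upwards [Ioi_mem_nhds (show (1:ℝ) < t - 1 by linarith)] with s hs
    exact smoothTransition.one_of_one_le (le_of_lt hs)
  unfold gg
  rw [e.deriv_eq, smoothTransition.one_of_one_le (by linarith)]
  simp

theorem gg_bdd : ∃ C : ℝ, ∀ t, 0 ≤ t → gg t ^ 2 ≤ C := by
  obtain ⟨C, hC⟩ := (isCompact_Icc (a := (0:ℝ)) (b := 2)).bddAbove_image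
    (f := fun t => gg t ^ 2) (continuous_gg.pow 2).continuousOn
  refine ⟨max C 1, fun t ht => ?_⟩
  rcases le_or_gt t 2 with h | h
  · exact (hC ⟨t, ⟨ht, h⟩, rfl⟩).trans (le_max_left _ _)
  · rw [gg_eq_one h]; simp

def tri (K : ℝ) (z : Config 2) : ℝ := rr z * smoothTransition (K * rr z - 1)

theorem admissible_tri {K : ℝ} (hK : 0 < K) : Admissible 2 (fun z => (tri K z : ℂ)) where
  smooth := by
    have : ContDiff ℝ (⊤ : ℕ∞) (tri K) := by
      unfold tri
      exact contDiff_rr.mul (smoothTransition.contDiff.comp ((contDiff_const.mul contDiff_rr).sub contDiff_const))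
    exact Complex.ofRealCLM.contDiff.comp this
  symm := by
    intro σ x
    have : rr (x ∘ σ) = rr x := by
      have h01 : σ 0 ≠ σ 1 := fun h => by simpa using σ.injective h
      rcases Fin.exists_fin_two.1 ⟨σ 0, rfl⟩ with h | h <;>
      rcases Fin.exists_fin_two.1 ⟨σ 1, rfl⟩ with h' | h'
      · exact absurd (h.trans h'.symm) h01
      · simp only [rr, Function.comp, h, h']
      · simp only [rr, Function.comp, h, h']; ring
      · exact absurd (h.trans h'.symm) h01
    simp [tri, this]
  vanishes := by
    refine ⟨{z | rr z < 1 / K}, isOpen_lt (contDiff_rr (n := 1)).continuous continuous_const, ?_, ?_⟩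
    · rintro z ⟨j, k, hjk, h⟩
      have : z 0 = z 1 := by
        fin_cases j <;> fin_cases k <;> simp_all
      simp [rr, this, hK]
    · intro z hz
      have : K * rr z - 1 ≤ 0 := by
        have : rr z < 1 / K := hz
        rw [lt_div_iff₀ hK] at this; linarith
      simp [tri, smoothTransition.zero_of_nonpos this]

theorem hasFDerivAt_rr (z : Config 2) : ∃ L : Config 2 →L[ℝ] ℝ, HasFDerivAt rr L z ∧
    L (Pi.single 0 (1,0)) = 2 * ((z 0).1 - (z 1).1) ∧ L (Pi.single 0 (0,1)) = 2 * ((z 0).2 - (z 1).2) ∧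
    L (Pi.single 1 (1,0)) = - (2 * ((z 0).1 - (z 1).1)) ∧
    L (Pi.single 1 (0,1)) = - (2 * ((z 0).2 - (z 1).2)) := by
  let P1 : Config 2 →L[ℝ] ℝ := (ContinuousLinearMap.fst ℝ ℝ ℝ).comp ((ContinuousLinearMap.proj 0 : Config 2 →L[ℝ] Plane) - ContinuousLinearMap.proj 1)
  let P2 : Config 2 →L[ℝ] ℝ := (ContinuousLinearMap.snd ℝ ℝ ℝ).comp ((ContinuousLinearMap.proj 0 : Config 2 →L[ℝ] Plane) - ContinuousLinearMap.proj 1)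
  have h := ((P1.hasFDerivAt (x := z)).pow 2).add ((P2.hasFDerivAt (x := z)).pow 2)
  refine ⟨_, h, ?_, ?_, ?_, ?_⟩ <;> simp [P1, P2]

theorem hasDerivAt_prof (K s : ℝ) : HasDerivAt (fun s => s * smoothTransition (K * s - 1)) (gg (K * s)) s := by
  have h1 : HasDerivAt smoothTransition (deriv smoothTransition (K * s - 1)) (K * s - 1) :=
    ((smoothTransition.contDiff (n := 1)).differentiable (by simp) _).hasDerivAt
  have h2 : HasDerivAt (fun s => K * s - 1) K s := by
    simpa using ((hasDerivAt_id s).const_mul K).sub_const 1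
  have := (hasDerivAt_id s).mul (h1.comp s h2)
  refine this.congr_deriv ?_
  simp [gg]; ring

theorem norm_aux (p q : ℝ) : ‖-Complex.I * (p : ℂ) + (q : ℂ)‖ ^ 2 = p ^ 2 + q ^ 2 := by
  rw [← Complex.normSq_eq_norm_sq, Complex.normSq_apply]
  simp; ring

theorem DSq_tri (K α : ℝ) (hα : α ∈ Icc (0:ℝ) 1) (z : Config 2) :
    ∑ j, DSq 2 α j (fun z => (tri K z : ℂ)) z ≤ 8 * rr z * gg (K * rr z) ^ 2 + 2 * rr z := by
  obtain ⟨L, hL, h1, h2, h3, h4⟩ := hasFDerivAt_rr z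
  have hd : HasFDerivAt (tri K) (gg (K * rr z) • L) z :=
    (hasDerivAt_prof K (rr z)).comp_hasFDerivAt z hL
  have hd2 : HasFDerivAt (fun z => (tri K z : ℂ)) (Complex.ofRealCLM.comp (gg (K * rr z) • L)) z :=
    Complex.ofRealCLM.hasFDerivAt.comp z hd
  have a0 : abPot 2 0 z = perpInv (z 0 - z 1) := by
    have : (Finset.univ : Finset (Fin 2)).erase 0 = {1} := by decide
    simp [abPot, this]
  have a1 : abPot 2 1 z = perpInv (z 1 - z 0) := by
    have : (Finset.univ : Finset (Fin 2)).erase 1 = {0} := by decide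
    simp [abPot, this]
  have hs0 := smoothTransition.nonneg (K * rr z - 1)
  have hs1 := smoothTransition.le_one (K * rr z - 1)
  have hr := rr_nonneg z
  have ht : tri K z ^ 2 ≤ rr z ^ 2 := by
    unfold tri
    have : rr z * smoothTransition (K * rr z - 1) ≤ rr z := mul_le_of_le_one_right hr hs1
    have : 0 ≤ rr z * smoothTransition (K * rr z - 1) := by positivity
    gcongr
  have hα2 : α ^ 2 ≤ 1 := by have := hα.1; have := hα.2; nlinarith
  rw [Fin.sum_univ_two]
  unfold DSq DOp pder
  rw [hd2.fderiv, a0, a1]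
  simp only [ContinuousLinearMap.comp_apply, _root_.smul_apply, h1, h2, h3, h4,
    Complex.ofRealCLM_apply, smul_eq_mul, ← Complex.ofReal_mul, norm_aux]
  set g := gg (K * rr z)
  set T := tri K z
  have key : ((-(z 0 - z 1).2 / rr z) ^ 2 + ((z 0 - z 1).1 / rr z) ^ 2) * T ^ 2 * α ^ 2 ≤ rr z := by
    rcases hr.eq_or_lt with h | h
    · rw [← h]; simp
    · have e : ((-(z 0 - z 1).2 / rr z) ^ 2 + ((z 0 - z 1).1 / rr z) ^ 2) = 1 / rr z := by
        field_simp
        simp only [rr, Prod.fst_sub, Prod.snd_sub]; ring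
      rw [e]
      calc 1 / rr z * T ^ 2 * α ^ 2 ≤ 1 / rr z * rr z ^ 2 * 1 := by gcongr
        _ = rr z := by field_simp
  have e0 : (z 0 - z 1).1 ^ 2 + (z 0 - z 1).2 ^ 2 = rr z := by simp [rr]
  have e1 : (z 1 - z 0).1 ^ 2 + (z 1 - z 0).2 ^ 2 = rr z := by simp only [rr, Prod.fst_sub, Prod.snd_sub]; ring
  simp only [perpInv, e0, e1]
  have e2 : (z 1 - z 0).1 = -(z 0 - z 1).1 := by simp
  have e3 : (z 1 - z 0).2 = -(z 0 - z 1).2 := by simp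
  rw [e2, e3]
  have e4 : 4 * (((z 0).1 - (z 1).1)^2 + ((z 0).2 - (z 1).2)^2) * g^2 = 4 * rr z * g^2 := by simp [rr]
  simp only [neg_div, neg_neg] at key ⊢
  nlinarith [key, e4]

theorem EN_two_le (α : ℝ) (hα : α ∈ Icc (0:ℝ) 1) : EN 2 α ≤ 18 := by
  obtain ⟨C, hC⟩ := gg_bdd
  have hcr : Continuous rr := (contDiff_rr (n := 1)).continuous
  have hcst := smoothTransition.continuous
  have hcg := continuous_gg
  let F : ℕ → Config 2 → ℝ := fun n z => 8 * rr z * gg ((n + 1 : ℝ) * rr z) ^ 2 + 2 * rr z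
    - 18 * tri (n + 1) z ^ 2
  have hFc : ∀ n, Continuous (F n) := by
    intro n; simp only [F, tri]; fun_prop
  have hlim : Filter.Tendsto (fun n => ∫ z in cube 2 Q0, F n z) Filter.atTop
      (𝓝 (∫ z in cube 2 Q0, (10 * rr z - 18 * rr z ^ 2))) := by
    apply tendsto_integral_of_dominated_convergence (fun z => 8 * rr z * C + 2 * rr z + 18 * rr z ^ 2)
    · intro n; exact (hFc n).aestronglyMeasurable
    · exact integrableOn_cube (by fun_prop)
    · intro n
      refine Filter.Eventually.of_forall fun z => ?_
      have hr := rr_nonneg z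
      have hg := hC ((n + 1 : ℝ) * rr z) (by positivity)
      have hs0 := smoothTransition.nonneg ((n+1:ℝ) * rr z - 1)
      have hs1 := smoothTransition.le_one ((n+1:ℝ) * rr z - 1)
      have ht : tri (n+1) z ^ 2 ≤ rr z ^ 2 := by
        unfold tri
        have : rr z * smoothTransition ((n+1:ℝ) * rr z - 1) ≤ rr z := mul_le_of_le_one_right hr hs1
        have : 0 ≤ rr z * smoothTransition ((n+1:ℝ) * rr z - 1) := by positivity
        gcongr
      have h1 : 8 * rr z * gg ((n + 1 : ℝ) * rr z) ^ 2 ≤ 8 * rr z * C := by gcongr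
      have h2 : 0 ≤ 8 * rr z * gg ((n + 1 : ℝ) * rr z) ^ 2 := by positivity
      have h3 := sq_nonneg (tri (n+1) z)
      rw [Real.norm_eq_abs, abs_le]
      simp only [F]
      constructor <;> nlinarith
    · refine Filter.Eventually.of_forall fun z => ?_
      rcases (rr_nonneg z).eq_or_lt with h | h
      · simp [F, tri, ← h]
      · apply tendsto_const_nhds.congr'
        obtain ⟨n0, hn0⟩ := exists_nat_gt (2 / rr z)
        filter_upwards [Filter.eventually_ge_atTop n0] with n hn
        have hn' : (n0 : ℝ) ≤ n := by exact_mod_cast hn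
        rw [div_lt_iff₀ h] at hn0
        have : 2 < (n + 1 : ℝ) * rr z := by nlinarith
        simp only [F, tri]
        rw [gg_eq_one this, smoothTransition.one_of_one_le (by linarith)]
        ring
  rw [integral_trial] at hlim
  obtain ⟨n, hn⟩ := (hlim.eventually (gt_mem_nhds (show (-1/15:ℝ) < 0 by norm_num))).exists
  have hK : (0:ℝ) < n + 1 := by positivity
  have had := admissible_tri hK
  set Ψ : Config 2 → ℂ := fun z => (tri (n+1) z : ℂ) with hΨ
  have hct : Continuous (tri (n+1)) := by unfold tri; fun_prop
  have hlt : kinE 2 α Q0 Ψ < 18 * normSq 2 Q0 Ψ := by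
    have e1 : kinE 2 α Q0 Ψ ≤ ∫ z in cube 2 Q0, (8 * rr z * gg ((n + 1 : ℝ) * rr z) ^ 2 + 2 * rr z) := by
      rw [kinE_eq had]
      apply integral_mono
      · exact integrableOn_cube (continuous_finsetSum _ fun j _ => had.continuous_DSq α j)
      · exact integrableOn_cube (by fun_prop)
      · intro z; exact DSq_tri _ α hα z
    have e2 : 18 * normSq 2 Q0 Ψ = ∫ z in cube 2 Q0, 18 * tri (n+1) z ^ 2 := by
      unfold normSq
      rw [← integral_const_mul]
      simp [hΨ]
    have e3 : ∫ z in cube 2 Q0, F n z = (∫ z in cube 2 Q0, (8 * rr z * gg ((n + 1 : ℝ) * rr z) ^ 2 + 2 * rr z))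
        - ∫ z in cube 2 Q0, 18 * tri (n+1) z ^ 2 := 
      integral_sub (integrableOn_cube (by fun_prop)) (integrableOn_cube (by fun_prop))
    linarith
  have h1 := EN_mul_le (by norm_num) α had
  have h0 := kinE_nonneg 2 Ψ α Q0
  have hp : 0 < normSq 2 Q0 Ψ := by linarith
  nlinarith

/-- product of all squared distances -/
def pp (N : ℕ) (x : Config N) : ℝ :=
  ∏ i, ∏ j, if i = j then 1 else (((x i).1 - (x j).1) ^ 2 + ((x i).2 - (x j).2) ^ 2)

theorem contDiff_pp (N : ℕ) {n : WithTop ℕ∞} : ContDiff ℝ n (pp N) := by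
  unfold pp
  apply contDiff_prod
  intro i _
  apply contDiff_prod
  intro j _
  split_ifs <;> fun_prop

theorem pp_symm (N : ℕ) (σ : Equiv.Perm (Fin N)) (x : Config N) : pp N (x ∘ σ) = pp N x := by
  unfold pp
  rw [← Equiv.prod_comp σ (fun i => ∏ j, if i = j then (1:ℝ) else (((x i).1 - (x j).1) ^ 2 + ((x i).2 - (x j).2) ^ 2))]
  refine Finset.prod_congr rfl fun i _ => ?_
  rw [← Equiv.prod_comp σ (fun j => if σ i = j then (1:ℝ) else (((x (σ i)).1 - (x j).1) ^ 2 + ((x (σ i)).2 - (x j).2) ^ 2))]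
  simp

theorem exists_admissible (N : ℕ) : ∃ Ψ : Config N → ℂ, Admissible N Ψ ∧ 0 < normSq N Q0 Ψ := by
  let x0 : Config N := fun i => (((i : ℕ) + 1 : ℝ) / (N + 1), 1 / 2)
  have hx0 : x0 ∈ cube N Q0 := by
    intro i _
    have : ((i : ℕ) : ℝ) + 1 ≤ N := by exact_mod_cast i.2
    refine ⟨⟨by positivity, ?_⟩, ⟨by norm_num [x0], by norm_num [x0]⟩⟩
    simp only [x0]
    rw [div_lt_one (by positivity)]; linarith
  have hp0 : 0 < pp N x0 := by
    unfold pp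
    refine Finset.prod_pos fun i _ => Finset.prod_pos fun j _ => ?_
    split_ifs with h
    · norm_num
    · have hne : (x0 i).1 - (x0 j).1 ≠ 0 := by
        simp only [x0]
        rw [← sub_div]
        apply div_ne_zero _ (by positivity)
        intro h2
        apply h
        have : ((i:ℕ) : ℝ) = (j:ℕ) := by linarith
        exact Fin.ext (by exact_mod_cast this)
      positivity
  set M : ℝ := 2 / pp N x0 with hM
  have hMp : 0 < M := by positivity
  let f : Config N → ℝ := fun x => smoothTransition (M * pp N x - 1)
  have hf : ContDiff ℝ (⊤ : ℕ∞) f :=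
    smoothTransition.contDiff.comp ((contDiff_const.mul (contDiff_pp N)).sub contDiff_const)
  refine ⟨fun x => (f x : ℂ), ⟨Complex.ofRealCLM.contDiff.comp hf, ?_, ?_⟩, ?_⟩
  · intro σ x
    simp [f, pp_symm]
  · refine ⟨{x | pp N x < 1 / M}, isOpen_lt (contDiff_pp N (n := 1)).continuous continuous_const, ?_, ?_⟩
    · rintro x ⟨j, k, hjk, h⟩
      have : pp N x = 0 := by
        unfold pp
        refine Finset.prod_eq_zero (Finset.mem_univ j) (Finset.prod_eq_zero (Finset.mem_univ k) ?_)
        simp [hjk, h]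
      simp [this, hMp]
    · intro x hx
      have : M * pp N x - 1 ≤ 0 := by
        have : pp N x < 1 / M := hx
        rw [lt_div_iff₀ hMp] at this; linarith
      simp [f, smoothTransition.zero_of_nonpos this]
  · unfold normSq
    have hc : Continuous (fun x => ‖(f x : ℂ)‖ ^ 2) := by
      have := hf.continuous
      fun_prop
    have hopen : IsOpen (cube N Q0) := isOpen_set_pi finite_univ fun _ _ => isOpen_Q0
    rw [setIntegral_pos_iff_support_of_nonneg_ae (Filter.Eventually.of_forall fun x => by positivity)
      (integrableOn_cube hc)]
    refine IsOpen.measure_pos _ (hc.isOpen_support.inter hopen) ⟨x0, ?_, hx0⟩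
    have : M * pp N x0 - 1 = 1 := by rw [hM]; field_simp; norm_num
    simp [f, this]

/-- the four corners -/
def cc (b : Bool × Bool) : Plane := (if b.1 then 1/2 else 0, if b.2 then 1/2 else 0)

theorem Qs_cc_subset (b : Bool × Bool) : Qs (cc b) ⊆ Q0 := by
  rintro ⟨x, y⟩ ⟨⟨h1, h2⟩, ⟨h3, h4⟩⟩
  obtain ⟨b1, b2⟩ := b
  cases b1 <;> cases b2 <;> simp only [cc, Q0, mem_prod, mem_Ioo] at * <;> norm_num at * <;>
    refine ⟨⟨?_, ?_⟩, ?_, ?_⟩ <;> linarith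

theorem Qs_cc_inj {b b' : Bool × Bool} {v : Plane} (h : v ∈ Qs (cc b)) (h' : v ∈ Qs (cc b')) : b = b' := by
  obtain ⟨b1, b2⟩ := b
  obtain ⟨b1', b2'⟩ := b'
  obtain ⟨⟨h1, h2⟩, ⟨h3, h4⟩⟩ := h
  obtain ⟨⟨h1', h2'⟩, ⟨h3', h4'⟩⟩ := h'
  have e1 : b1 = b1' := by
    cases b1 <;> cases b1' <;> simp [cc] at * <;> linarith
  have e2 : b2 = b2' := by
    cases b2 <;> cases b2' <;> simp [cc] at * <;> linarith
  rw [e1, e2]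

theorem Qs_subset_Qc (c : Plane) : Qs c ⊆ Qc c := prod_mono Ioo_subset_Icc_self Ioo_subset_Icc_self

abbrev Idx (N : ℕ) : Type := (Bool × Bool) × (Fin N × Fin N)

def Si {N : ℕ} (i : Idx N) : Set (Config N) := SS ![i.2.1, i.2.2] (cc i.1)

theorem Si_fst {N : ℕ} {i : Idx N} {x : Config N} (h : x ∈ Si i) : x i.2.1 ∈ Qs (cc i.1) := by
  have := h i.2.1 (mem_univ _)
  simpa [tS] using this

theorem Si_snd {N : ℕ} {i : Idx N} {x : Config N} (h : x ∈ Si i) : x i.2.2 ∈ Qs (cc i.1) := by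
  have := h i.2.2 (mem_univ _)
  simpa [tS] using this

theorem Si_other {N : ℕ} {i : Idx N} {x : Config N} (h : x ∈ Si i) {l : Fin N} (hl : x l ∈ Qs (cc i.1)) :
    l = i.2.1 ∨ l = i.2.2 := by
  by_contra hne
  have := h l (mem_univ _)
  have e : tS ![i.2.1, i.2.2] (cc i.1) l = Q0 \ Qc (cc i.1) := if_neg hne
  rw [e] at this
  exact this.2 (Qs_subset_Qc _ hl)

def II (N : ℕ) : Finset (Idx N) := Finset.univ ×ˢ Finset.univ.offDiag

theorem mem_II {N : ℕ} {i : Idx N} : i ∈ II N ↔ i.2.1 ≠ i.2.2 := by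
  simp [II]

theorem inj_fst {N : ℕ} {i i' : Idx N} (hi : i ∈ II N) (hi' : i' ∈ II N) {x : Config N} (h : x ∈ Si i) (h' : x ∈ Si i')
    (e : i.2.1 = i'.2.1) : i = i' := by
  rw [mem_II] at hi hi'
  have h1 := Si_fst h
  have h1' := Si_fst h'
  rw [← e] at h1'
  have hc := Qs_cc_inj h1 h1'
  have h2 := Si_snd h
  rw [hc] at h2
  rcases Si_other h' h2 with h3 | h3
  · exact absurd (e.trans h3.symm) hi
  · exact Prod.ext hc (Prod.ext e h3)

theorem inj_snd {N : ℕ} {i i' : Idx N} (hi : i ∈ II N) (hi' : i' ∈ II N) {x : Config N} (h : x ∈ Si i) (h' : x ∈ Si i')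
    (e : i.2.2 = i'.2.2) : i = i' := by
  rw [mem_II] at hi hi'
  have h1 := Si_snd h
  have h1' := Si_snd h'
  rw [← e] at h1'
  have hc := Qs_cc_inj h1 h1'
  have h2 := Si_fst h
  rw [hc] at h2
  rcases Si_other h' h2 with h3 | h3
  · exact Prod.ext hc (Prod.ext h3 e)
  · exact absurd (h3.trans e.symm) hi

open Classical in
theorem sum_inj_le {N : ℕ} (x : Config N) (w : Fin N → ℝ) (hw : ∀ j, 0 ≤ w j) (p : Idx N → Fin N)
    (hp : ∀ i ∈ II N, ∀ i' ∈ II N, x ∈ Si i → x ∈ Si i' → p i = p i' → i = i') :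
    ∑ i ∈ II N, (if x ∈ Si i then w (p i) else 0) ≤ ∑ j, w j := by
  rw [← Finset.sum_filter]
  rw [← Finset.sum_image (g := p) (f := w)]
  · exact Finset.sum_le_sum_of_subset_of_nonneg (Finset.subset_univ _) fun j _ _ => hw j
  · intro i hi i' hi' e
    simp only [Finset.coe_filter, mem_ofPred_eq] at hi hi'
    exact hp i hi.1 i' hi'.1 hi.2 hi'.2 e

open Classical in
theorem card_le_eight {N : ℕ} (x : Config N) : ∑ i ∈ II N, (if x ∈ Si i then (1:ℝ) else 0) ≤ 8 := by
  unfold II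
  rw [Finset.sum_product]
  have : ∀ b ∈ (Finset.univ : Finset (Bool × Bool)),
      ∑ q ∈ (Finset.univ : Finset (Fin N)).offDiag, (if x ∈ Si (b, q) then (1:ℝ) else 0) ≤ 2 := by
    intro b _
    rw [Finset.sum_boole]
    have : ((Finset.univ : Finset (Fin N)).offDiag.filter (fun q => x ∈ Si (b, q))).card ≤ 2 := by
      rcases Finset.eq_empty_or_nonempty
        ((Finset.univ : Finset (Fin N)).offDiag.filter (fun q => x ∈ Si (b, q))) with h | ⟨q, hq⟩
      · rw [h]; simp
      · rw [Finset.mem_filter] at hq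
        refine (Finset.card_le_card (t := {q, (q.2, q.1)}) ?_).trans Finset.card_le_two
        intro q' hq'
        rw [Finset.mem_filter] at hq'
        have n' : q'.1 ≠ q'.2 := by simpa using hq'.1
        have a := Si_other (i := (b, q)) hq.2 (Si_fst (i := (b, q')) hq'.2)
        have a' := Si_other (i := (b, q)) hq.2 (Si_snd (i := (b, q')) hq'.2)
        simp only [Finset.mem_insert, Finset.mem_singleton, Prod.ext_iff]
        simp only at a a'
        grind
    exact_mod_cast this
  refine (Finset.sum_le_sum this).trans ?_
  simp
  norm_num

theorem measurableSet_Si {N : ℕ} (i : Idx N) : MeasurableSet (Si i) := measurableSet_SS _ _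

theorem Si_subset {N : ℕ} (i : Idx N) : Si i ⊆ cube N Q0 := SS_subset _ _ (Qs_cc_subset _)

theorem volume_Qs (c : Plane) : volume (Qs c) = ENNReal.ofReal (1/4) := by
  unfold Qs
  rw [show (volume : Measure Plane) = (volume : Measure ℝ).prod volume from rfl, Measure.prod_prod,
    Real.volume_Ioo, Real.volume_Ioo, ← ENNReal.ofReal_mul (by norm_num)]
  norm_num

theorem volume_Qc (c : Plane) : volume (Qc c) = ENNReal.ofReal (1/4) := by
  unfold Qc
  rw [show (volume : Measure Plane) = (volume : Measure ℝ).prod volume from rfl, Measure.prod_prod,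
    Real.volume_Icc, Real.volume_Icc, ← ENNReal.ofReal_mul (by norm_num)]
  norm_num

theorem volume_compl (c : Plane) : ENNReal.ofReal (3/4) ≤ volume (Q0 \ Qc c) := by
  refine le_trans ?_ (le_measure_sdiff (μ := volume) (s₁ := Q0) (s₂ := Qc c))
  rw [volume_Q0, volume_Qc, ← ENNReal.ofReal_one, ← ENNReal.ofReal_sub _ (by norm_num)]
  norm_num

theorem volume_Si {N : ℕ} {i : Idx N} (hi : i ∈ II N) :
    (1/16 : ℝ) * (3/4) ^ (N - 2) ≤ volume.real (Si i) := by
  rw [mem_II] at hi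
  have hfin : volume (Si i) ≠ ⊤ := by
    have := measure_mono (μ := volume) (Si_subset i)
    rw [volume_cube] at this
    exact (this.trans_lt ENNReal.one_lt_top).ne
  unfold Measure.real
  rw [← ENNReal.ofReal_le_iff_le_toReal hfin]
  unfold Si SS
  rw [volume_pi_pi, prod_split (J := ![i.2.1, i.2.2]) (by simpa using hi)]
  have hp : ENNReal.ofReal (3/4) ^ (N - 2) ≤
      ∏ l ∈ (Finset.univ.erase (![i.2.1, i.2.2] 0)).erase (![i.2.1, i.2.2] 1), volume (tS ![i.2.1, i.2.2] (cc i.1) l) := by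
    have hcard : ((Finset.univ.erase (![i.2.1, i.2.2] 0)).erase (![i.2.1, i.2.2] 1)).card = N - 2 := by
      rw [Finset.card_erase_of_mem (by simpa using hi.symm), Finset.card_erase_of_mem (by simp)]
      simp; omega
    rw [← hcard]
    apply Finset.pow_card_le_prod
    intro l hl
    simp only [Finset.mem_erase, Finset.mem_univ, and_true] at hl
    unfold tS
    rw [if_neg (by tauto)]
    exact volume_compl _
  have h0 : tS ![i.2.1, i.2.2] (cc i.1) (![i.2.1, i.2.2] 0) = Qs (cc i.1) := by simp [tS]
  have h1 : tS ![i.2.1, i.2.2] (cc i.1) (![i.2.1, i.2.2] 1) = Qs (cc i.1) := by simp [tS]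
  rw [h0, h1, volume_Qs]
  calc ENNReal.ofReal ((1/16 : ℝ) * (3/4) ^ (N - 2))
      = ENNReal.ofReal (1/4) * (ENNReal.ofReal (1/4) * ENNReal.ofReal (3/4) ^ (N - 2)) := by
        rw [← ENNReal.ofReal_pow (by norm_num), ← ENNReal.ofReal_mul (by norm_num), ← ENNReal.ofReal_mul (by norm_num)]
        congr 1; ring
    _ ≤ _ := by gcongr

theorem sum_volume (N : ℕ) : (N.choose 2 : ℝ) * (3/4) ^ (N - 2) ≤ 2 * ∑ i ∈ II N, volume.real (Si i) := by
  have h := Finset.sum_le_sum (fun i (hi : i ∈ II N) => volume_Si hi)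
  rw [Finset.sum_const, nsmul_eq_mul] at h
  have hc : ((II N).card : ℝ) = 8 * (N.choose 2 : ℝ) := by
    unfold II
    rw [Finset.card_product, Finset.offDiag_card]
    simp only [Finset.card_univ, Fintype.card_prod, Fintype.card_bool, Fintype.card_fin]
    rw [Nat.cast_choose_two]
    rw [Nat.cast_mul, Nat.cast_sub (Nat.le_mul_self N)]
    push_cast; ring
  rw [hc] at h
  nlinarith [h]

open Classical in
theorem sum_int_le {N : ℕ} (f : Idx N → Config N → ℝ) (hf : ∀ i, Continuous (f i)) (G : Config N → ℝ)
    (hG : Continuous G) (hle : ∀ x, ∑ i ∈ II N, (if x ∈ Si i then f i x else 0) ≤ G x) :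
    ∑ i ∈ II N, ∫ x in Si i, f i x ≤ ∫ x in cube N Q0, G x := by
  have h1 : ∀ i ∈ II N, ∫ x in Si i, f i x = ∫ x in cube N Q0, (Si i).indicator (f i) x := by
    intro i _
    rw [setIntegral_indicator (measurableSet_Si i), inter_eq_right.2 (Si_subset i)]
  have hIntg : ∀ i ∈ II N, IntegrableOn ((Si i).indicator (f i)) (cube N Q0) := fun i _ =>
    Integrable.indicator (integrableOn_cube (hf i)) (measurableSet_Si i)
  rw [Finset.sum_congr rfl h1, ← integral_finsetSum _ hIntg]
  apply integral_mono (integrable_finsetSum _ hIntg) (integrableOn_cube hG)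
  intro x
  refine le_trans (le_of_eq ?_) (hle x)
  exact Finset.sum_congr rfl fun i _ => by simp [indicator]

theorem main_ineq (α : ℝ) (hα : α ∈ Icc (0:ℝ) 1) (N : ℕ) {Ψ : Config N → ℂ} (h : Admissible N Ψ)
    (hn : normSq N Q0 Ψ = 1) (b : ℝ) (hb : b = (N.choose 2 : ℝ) * (3/4) ^ (N - 2)) :
    b * EN 2 α ≤ ((1 + 4 * Real.sqrt 2) ^ 2 + 2 * b) * kinE N α Q0 Ψ := by
  classical
  set T := kinE N α Q0 Ψ with hT
  set E := EN 2 α with hE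
  set t := 4 * Real.sqrt 2 with ht
  have ht2 : t ^ 2 = 32 := by rw [ht, mul_pow, Real.sq_sqrt (by norm_num)]; norm_num
  have ht0 : 0 ≤ t := by positivity
  have hE0 : 0 ≤ E := EN_nonneg 2 α
  have hE18 : E ≤ 18 := EN_two_le α hα
  have hT0 : 0 ≤ T := kinE_nonneg N Ψ α Q0
  have hb0 : 0 ≤ b := by rw [hb]; positivity
  have hcΨ := h.smooth.continuous
  set m := ∫ x in cube N Q0, ‖Ψ x‖ with hm
  have hvar := var_norm_le h α
  rw [hn, ← hm, ← hT] at hvar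
  set A := ∑ i ∈ II N, ∫ x in Si i, ‖Ψ x‖ ^ 2 with hA
  set B := ∑ i ∈ II N, ∫ x in Si i, (‖Ψ x‖ - m) ^ 2 with hB
  have hcD := fun j => h.continuous_DSq α j
  -- local energies
  have s1 : 2 * E * A ≤ T := by
    have l1 : ∑ i ∈ II N, 4 * E * ∫ x in Si i, ‖Ψ x‖ ^ 2 ≤
        ∑ i ∈ II N, ∫ x in Si i, (DSq N α i.2.1 Ψ x + DSq N α i.2.2 Ψ x) := by
      apply Finset.sum_le_sum
      intro i hi
      exact local_bound (J := ![i.2.1, i.2.2]) (by simpa using mem_II.1 hi) (cc i.1) (Qs_cc_subset _) α h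
    have l2 : ∑ i ∈ II N, ∫ x in Si i, (DSq N α i.2.1 Ψ x + DSq N α i.2.2 Ψ x) ≤
        ∫ x in cube N Q0, 2 * ∑ j, DSq N α j Ψ x := by
      apply sum_int_le (fun i x => DSq N α i.2.1 Ψ x + DSq N α i.2.2 Ψ x)
        (fun i => (hcD _).add (hcD _)) _ (by fun_prop)
      intro x
      have w := DSq_nonneg N α (Ψ := Ψ) (x := x)
      have p1 := sum_inj_le x (fun j => DSq N α j Ψ x) w (fun i => i.2.1)
        (fun i hi i' hi' a a' e => inj_fst hi hi' a a' e)
      have p2 := sum_inj_le x (fun j => DSq N α j Ψ x) w (fun i => i.2.2)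
        (fun i hi i' hi' a a' e => inj_snd hi hi' a a' e)
      have e : ∑ i ∈ II N, (if x ∈ Si i then DSq N α i.2.1 Ψ x + DSq N α i.2.2 Ψ x else 0) =
          ∑ i ∈ II N, (if x ∈ Si i then DSq N α i.2.1 Ψ x else 0) +
          ∑ i ∈ II N, (if x ∈ Si i then DSq N α i.2.2 Ψ x else 0) := by
        rw [← Finset.sum_add_distrib]
        refine Finset.sum_congr rfl fun i _ => ?_
        split_ifs <;> simp
      rw [e]; linarith
    rw [integral_const_mul, ← kinE_eq h, ← Finset.mul_sum] at *
    linarith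
  -- overlap
  have s2 : B ≤ 8 * (1 - m ^ 2) := by
    have l2 : B ≤ ∫ x in cube N Q0, 8 * (‖Ψ x‖ - m) ^ 2 := by
      apply sum_int_le (fun i x => (‖Ψ x‖ - m) ^ 2) (fun i => by fun_prop) _ (by fun_prop)
      intro x
      have := mul_le_mul_of_nonneg_right (card_le_eight x) (sq_nonneg (‖Ψ x‖ - m))
      rw [Finset.sum_mul] at this
      simpa [ite_mul] using this
    have e : ∫ x in cube N Q0, (‖Ψ x‖ - m) ^ 2 = 1 - m ^ 2 := by
      have e1 : ∀ x, (‖Ψ x‖ - m) ^ 2 = ‖Ψ x‖ ^ 2 - (2 * m) * ‖Ψ x‖ + m ^ 2 := fun x => by ring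
      simp only [e1]
      rw [integral_add (integrableOn_cube (by fun_prop)) (integrableOn_cube (by fun_prop)),
        integral_sub (integrableOn_cube (by fun_prop)) (integrableOn_cube (by fun_prop)),
        integral_const_mul, ← hm, integral_const]
      have : ∫ x in cube N Q0, ‖Ψ x‖ ^ 2 = 1 := hn
      rw [this]
      simp
      ring
    rw [integral_const_mul, e] at l2
    exact l2
  -- Cauchy-Schwarz
  have s3 : (∑ i ∈ II N, volume.real (Si i)) * m ^ 2 ≤ (1 + t) * A + (1 + t / 32) * B := by
    rw [hA, hB, Finset.mul_sum, Finset.mul_sum, Finset.sum_mul, ← Finset.sum_add_distrib]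
    apply Finset.sum_le_sum
    intro i _
    have hi1 : ∀ f : Config N → ℝ, Continuous f → IntegrableOn f (Si i) := fun f hf =>
      (integrableOn_cube hf).mono_set (Si_subset i)
    rw [← integral_const_mul, ← integral_const_mul,
      ← integral_add (hi1 _ (by fun_prop)) (hi1 _ (by fun_prop))]
    have : volume.real (Si i) * m ^ 2 = ∫ x in Si i, m ^ 2 := by simp
    rw [this]
    apply integral_mono (hi1 _ (by fun_prop)) (hi1 _ (by fun_prop))
    intro x
    set u := ‖Ψ x‖
    have k := mul_nonneg ht0 (sq_nonneg (u + (u - m) * t / 32))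
    have k2 : t * (u + (u - m) * t / 32) ^ 2 = t * u ^ 2 + t ^ 2 * (u * (u - m)) / 16
      + t * t ^ 2 * (u - m) ^ 2 / 1024 := by ring
    rw [k2, ht2] at k
    simp only
    nlinarith [k]
  have s4 := sum_volume N
  rw [← hb] at s4
  have hV : 0 ≤ 1 - m ^ 2 := by
    have : 0 ≤ B := Finset.sum_nonneg fun i _ => integral_nonneg fun x => sq_nonneg _
    linarith
  have r1 : b * m ^ 2 ≤ 2 * ((1 + t) * A + (1 + t / 32) * (8 * (1 - m ^ 2))) := by
    have := mul_le_mul_of_nonneg_right s4 (sq_nonneg m)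
    have := mul_le_mul_of_nonneg_left s2 (show 0 ≤ 1 + t / 32 by positivity)
    linarith
  have r2 : E * (1 - m ^ 2) ≤ 2 * T := by
    have := mul_le_mul_of_nonneg_right hE18 hV
    linarith
  have r3 := mul_le_mul_of_nonneg_left r1 hE0
  have r4 := mul_le_mul_of_nonneg_left s1 (show 0 ≤ 1 + t by positivity)
  have r5 := mul_le_mul_of_nonneg_left r2 (show 0 ≤ 16 * (1 + t / 32) by positivity)
  have r6 := mul_le_mul_of_nonneg_left r2 hb0
  have e7 : (1 + t) ^ 2 = 33 + 2 * t := by rw [add_sq, ht2]; ring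
  rw [e7]
  nlinarith [r3, r4, r5, r6]

/-- Uniform a priori bound: for `α ∈ [0,1]` and `N ≥ 3`, with
`b_N := binom(N,2)(3/4)^{N−2}`,
`E^N_N(α) ≥ [b_N / ((1 + 4√2)² + 2 b_N)] E^N_2(α)`. -/
theorem apriori_bound_uniform (α : ℝ) (hα : α ∈ Set.Icc (0 : ℝ) 1)
    (N : ℕ) (hN : 3 ≤ N) :
    ((N.choose 2 : ℝ) * (3 / 4) ^ (N - 2)) /
        ((1 + 4 * Real.sqrt 2) ^ 2 + 2 * ((N.choose 2 : ℝ) * (3 / 4) ^ (N - 2))) *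
      EN 2 α ≤ EN N α := by
  have hN0 : N ≠ 0 := by omega
  rw [show EN N α = sInf {E | ∃ Ψ : Config N → ℂ, Admissible N Ψ ∧ normSq N Q0 Ψ = 1 ∧ E = kinE N α Q0 Ψ} by
    simp [EN, neumannE, hN0]]
  apply le_csInf
  · obtain ⟨Ψ, h, h0⟩ := exists_admissible N
    obtain ⟨Φ, hΦ, h1, -⟩ := exists_normalized h h0
    exact ⟨_, Φ, hΦ, h1, rfl⟩
  · rintro _ ⟨Ψ, h, h1, rfl⟩
    have := main_ineq α hα N h h1 _ rfl
    rw [div_mul_eq_mul_div, div_le_iff₀ (by positivity)]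
    linarith
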